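/- arXiv:2112.00306 — 3 statements merged into one kernel-verified Lean document; each statement's English description precedes it below -/
import Mathlib

section
/- (Many directions from a single point) There exists an absolute constant K > 0 such that for every finite set Q ⊆ ℝ² with |Q| ≥ 2 in which no line contains more than √|Q| points of Q, there exists a point α ∈ Q such that the set of distinct lines passing through α and at least one other point of Q has at least |Q|/K elements; in particular the slopes of the segments from α to the other points of Q take at least |Q|/K distinct values. -/
/-- A line in `ℝ²`: a set of the form `{(x,y) : a·x + b·y = c}` with `(a,b) ≠ (0,0)`. -/
def IsLine (ℓ : Set (ℝ × ℝ)) : Prop :=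
  ∃ a b c : ℝ, (a, b) ≠ (0, 0) ∧ ℓ = {p : ℝ × ℝ | a * p.1 + b * p.2 = c}


/-- The height at abscissa `x` of the line with slope `L.1` and intercept `L.2`. -/
def lineY (L : ℝ × ℝ) (x : ℝ) : ℝ := L.1 * x + L.2

theorem lineY_noCross (A B : ℝ × ℝ) (p q : ℝ) (hpq : p < q)
    (hN : ∀ x, p < x → x < q → lineY A x ≠ lineY B x)
    (h1 : lineY A p < lineY B p) : lineY A q ≤ lineY B q := by
  by_contra h2
  push Not at h2
  unfold lineY at *
  set u := B.1 * p + B.2 - (A.1 * p + A.2) with hu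
  set v := A.1 * q + A.2 - (B.1 * q + B.2) with hv
  have hu0 : 0 < u := by linarith
  have hv0 : 0 < v := by linarith
  have hs : 0 < u + v := by linarith
  have key : (q - p) * (A.1 - B.1) = u + v := by rw [hu, hv]; ring
  refine hN (p + u / (u + v) * (q - p)) ?_ ?_ ?_
  · have : 0 < u / (u + v) * (q - p) := by
      apply mul_pos (div_pos hu0 hs); linarith
    linarith
  · have : u / (u + v) < 1 := by rw [div_lt_one hs]; linarith
    nlinarith
  · have h3 : u / (u + v) * ((q - p) * (A.1 - B.1)) = u := by
      rw [key]; field_simp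
    linear_combination h3 + hu

theorem planar_bound {ι : Type*} (E : Finset ι) (S : Finset (ℝ × ℝ))
    (hS : Set.InjOn Prod.fst (S : Set (ℝ × ℝ))) (L l r : ι → ℝ × ℝ)
    (hl : ∀ i ∈ E, l i ∈ S) (hr : ∀ i ∈ E, r i ∈ S)
    (hlt : ∀ i ∈ E, (l i).1 < (r i).1)
    (hlL : ∀ i ∈ E, (l i).2 = lineY (L i) (l i).1)
    (hrL : ∀ i ∈ E, (r i).2 = lineY (L i) (r i).1)
    (hN : ∀ i ∈ E, ∀ j ∈ E, i ≠ j → ∀ x, (l i).1 < x → x < (r i).1 → (l j).1 < x →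
      x < (r j).1 → lineY (L i) x ≠ lineY (L j) x) :
    E.card ≤ 3 * S.card := by
  classical
  have hslope : ∀ i ∈ E, ∀ j ∈ E, l i = l j → (L i).1 = (L j).1 → i = j := by
    intro i hi j hj h1 h2
    by_contra hne
    have hi1 := hlt i hi
    have hj1 := hlt j hj
    have hm : (l i).1 < min (r i).1 (r j).1 := lt_min hi1 (by rw [h1]; exact hj1)
    obtain ⟨x, hx1, hx2⟩ := exists_between hm
    refine hN i hi j hj hne x hx1 (lt_of_lt_of_le hx2 (min_le_left _ _)) (by rw [← h1]; exact hx1)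
      (lt_of_lt_of_le hx2 (min_le_right _ _)) ?_
    have e1 := hlL i hi
    have e2 := hlL j hj
    rw [← h1] at e2
    unfold lineY at *
    rw [h2] at *
    linarith
  have hcross : ∀ i ∈ E, ∀ j ∈ E, i ≠ j → ∀ p q, p < q → (l i).1 ≤ p → (l j).1 ≤ p →
      q ≤ (r i).1 → q ≤ (r j).1 → lineY (L i) p < lineY (L j) p →
      lineY (L j) q < lineY (L i) q → False := by
    intro i hi j hj hne p q hpq h1 h2 h3 h4 h5 h6
    have := lineY_noCross (L i) (L j) p q hpq (fun x hx1 hx2 => hN i hi j hj hne x (by linarith)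
      (by linarith) (by linarith) (by linarith)) h5
    linarith
  let Top : ι → Prop := fun i => ∀ j ∈ E, l j = l i → (L j).1 ≤ (L i).1
  let W : ι → ι → ℝ × ℝ → Prop := fun i j w =>
    j ∈ E ∧ l j = l i ∧ (L i).1 < (L j).1 ∧
    (∀ k ∈ E, l k = l i → (L i).1 < (L k).1 → (L j).1 ≤ (L k).1) ∧
    w ∈ S ∧ (l i).1 < w.1 ∧ w.1 ≤ (r i).1 ∧ w.1 ≤ (r j).1 ∧
    lineY (L i) w.1 ≤ w.2 ∧ w.2 ≤ lineY (L j) w.1 ∧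
    ∀ s ∈ S, (l i).1 < s.1 → s.1 < w.1 → lineY (L i) s.1 ≤ s.2 → s.2 ≤ lineY (L j) s.1 → False
  have habove : ∀ i ∈ E, ∀ j ∈ E, l j = l i → (L i).1 < (L j).1 → ∀ x, (l i).1 < x →
      lineY (L i) x < lineY (L j) x := by
    intro i hi j hj h1 h2 x hx
    have e1 := hlL i hi
    have e2 := hlL j hj
    rw [h1] at e2
    unfold lineY at *
    nlinarith
  have hex : ∀ i ∈ E, ¬ Top i → ∃ j w, W i j w := by
    intro i hi hT
    have hT' : ∃ j ∈ E, l j = l i ∧ (L i).1 < (L j).1 := by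
      by_contra hcon
      push Not at hcon
      exact hT hcon
    obtain ⟨j0, hj0, hj0l, hj0s⟩ := hT'
    obtain ⟨j, hj, hjmin⟩ := Finset.exists_min_image
      (E.filter fun k => l k = l i ∧ (L i).1 < (L k).1) (fun k => (L k).1)
      ⟨j0, by simp [hj0, hj0l, hj0s]⟩
    rw [Finset.mem_filter] at hj
    obtain ⟨hjE, hjl, hjs⟩ := hj
    have hab := habove i hi j hjE hjl hjs
    have hne : (S.filter fun s => (l i).1 < s.1 ∧ s.1 ≤ (r i).1 ∧ s.1 ≤ (r j).1 ∧
        lineY (L i) s.1 ≤ s.2 ∧ s.2 ≤ lineY (L j) s.1).Nonempty := by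
      rcases le_total (r i).1 (r j).1 with h | h
      · refine ⟨r i, ?_⟩
        rw [Finset.mem_filter]
        refine ⟨hr i hi, hlt i hi, le_rfl, h, (hrL i hi).ge, ?_⟩
        rw [hrL i hi]
        exact (hab _ (hlt i hi)).le
      · have hlt' : (l i).1 < (r j).1 := by rw [← hjl]; exact hlt j hjE
        refine ⟨r j, ?_⟩
        rw [Finset.mem_filter]
        refine ⟨hr j hjE, hlt', h, le_rfl, ?_, (hrL j hjE).le⟩
        rw [hrL j hjE]
        exact (hab _ hlt').le
    obtain ⟨w, hw, hwmin⟩ := Finset.exists_min_image _ (fun s : ℝ × ℝ => s.1) hne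
    rw [Finset.mem_filter] at hw
    obtain ⟨hwS, hw1, hw2, hw3, hw4, hw5⟩ := hw
    refine ⟨j, w, hjE, hjl, hjs, ?_, hwS, hw1, hw2, hw3, hw4, hw5, ?_⟩
    · intro k hk hk1 hk2
      exact hjmin k (by simp [hk, hk1, hk2])
    · intro s hs h1 h2 h3 h4
      have := hwmin s (by
        rw [Finset.mem_filter]
        exact ⟨hs, h1, by linarith, by linarith, h3, h4⟩)
      linarith
  have huniq0 : ∀ i ∈ E, ∀ i' ∈ E, ∀ j j' w, W i j w → W i' j' w → (l i).1 ≤ (l i').1 →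
      lineY (L i) w.1 < lineY (L j') w.1 → lineY (L i') w.1 < lineY (L j) w.1 → i = i' := by
    intro i hi i' hi' j j' w hW hW' hle h1 h2
    obtain ⟨a1, a2, a3, a4, a5, a6, a7, a8, a9, a10, a11⟩ := hW
    obtain ⟨b1, b2, b3, b4, b5, b6, b7, b8, b9, b10, b11⟩ := hW'
    rcases hle.lt_or_eq with hlt' | heq
    · exfalso
      have hu := hl i' hi'
      have e' := hlL i' hi'
      have ej' := hlL j' b1
      rw [b2] at ej'
      rcases lt_or_ge (l i').2 (lineY (L i) (l i').1) with hb | hb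
      · refine hcross j' b1 i hi ?_ (l i').1 w.1 b6 (by rw [b2]) hlt'.le b8 a7 (by linarith) h1
        rintro rfl
        rw [b2] at hlt'
        exact lt_irrefl _ hlt'
      · rcases lt_or_ge (lineY (L j) (l i').1) (l i').2 with hc | hc
        · refine hcross j a1 i' hi' ?_ (l i').1 w.1 b6 (by rw [a2]; exact hlt'.le) le_rfl a8 b7
            (by linarith) h2
          rintro rfl
          rw [a2] at hlt'
          exact lt_irrefl _ hlt'
        · exact a11 _ hu hlt' b6 hb hc
    · have hll : l i = l i' := hS (hl i hi) (hl i' hi') heq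
      rcases lt_trichotomy (L i).1 (L i').1 with h | h | h
      · exfalso
        have h3 := a4 i' hi' hll.symm h
        have e1 := hlL j a1
        have e2 := hlL i' hi'
        rw [a2, hll] at e1
        unfold lineY at *
        nlinarith
      · exact hslope i hi i' hi' hll h
      · exfalso
        have h3 := b4 i hi hll h
        have e1 := hlL j' b1
        have e2 := hlL i hi
        rw [b2, ← hll] at e1
        unfold lineY at *
        nlinarith
  have huniq : ∀ i ∈ E, ∀ i' ∈ E, ∀ j j' w, W i j w → W i' j' w →
      lineY (L i) w.1 < lineY (L j') w.1 → lineY (L i') w.1 < lineY (L j) w.1 → i = i' := by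
    intro i hi i' hi' j j' w hW hW' h1 h2
    rcases le_total (l i).1 (l i').1 with h | h
    · exact huniq0 i hi i' hi' j j' w hW hW' h h1 h2
    · exact (huniq0 i' hi' i hi j' j w hW' hW h h2 h1).symm
  choose! J w hW using hex
  have hc0 : (E.filter fun i => Top i).card ≤ S.card := by
    apply Finset.card_le_card_of_injOn l
    · intro i hi
      exact hl i (Finset.mem_filter.1 hi).1
    · intro i hi j hj hij
      have hi := Finset.mem_filter.1 hi
      have hj := Finset.mem_filter.1 hj
      exact hslope i hi.1 j hj.1 hij (le_antisymm (hj.2 i hi.1 hij) (hi.2 j hj.1 hij.symm))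
  have hc1 : (E.filter fun i => ¬ Top i ∧ lineY (L i) (w i).1 < (w i).2).card ≤ S.card := by
    apply Finset.card_le_card_of_injOn w
    · intro i hi
      have hi := Finset.mem_filter.1 hi
      exact (hW i hi.1 hi.2.1).2.2.2.2.1
    · intro i hi j hj hij
      have hi := Finset.mem_filter.1 hi
      have hj := Finset.mem_filter.1 hj
      have h1 := hW i hi.1 hi.2.1
      have h2 := hW j hj.1 hj.2.1
      have h3 := hi.2.2
      have h4 := hj.2.2
      rw [← hij] at h2 h4
      have h5 := h1.2.2.2.2.2.2.2.2.2.1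
      have h6 := h2.2.2.2.2.2.2.2.2.2.1
      exact huniq i hi.1 j hj.1 _ _ _ h1 h2 (by linarith) (by linarith)
  have hc2 : (E.filter fun i => ¬ Top i ∧ ¬ lineY (L i) (w i).1 < (w i).2).card ≤ S.card := by
    apply Finset.card_le_card_of_injOn w
    · intro i hi
      have hi := Finset.mem_filter.1 hi
      exact (hW i hi.1 hi.2.1).2.2.2.2.1
    · intro i hi j hj hij
      have hi := Finset.mem_filter.1 hi
      have hj := Finset.mem_filter.1 hj
      have h1 := hW i hi.1 hi.2.1
      have h2 := hW j hj.1 hj.2.1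
      have h3 := hi.2.2
      have h4 := hj.2.2
      rw [← hij] at h2 h4
      have h5 := h1.2.2.2.2.2.2.2.2.1
      have h6 := h2.2.2.2.2.2.2.2.2.1
      have h7 := habove i hi.1 _ h1.1 h1.2.1 h1.2.2.1 _ h1.2.2.2.2.2.1
      have h8 := habove j hj.1 _ h2.1 h2.2.1 h2.2.2.1 _ h2.2.2.2.2.2.1
      exact huniq i hi.1 j hj.1 _ _ _ h1 h2 (by linarith) (by linarith)
  have hcover : E ⊆ (E.filter fun i => Top i) ∪
      ((E.filter fun i => ¬ Top i ∧ lineY (L i) (w i).1 < (w i).2) ∪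
       (E.filter fun i => ¬ Top i ∧ ¬ lineY (L i) (w i).1 < (w i).2)) := by
    intro i hi
    simp only [Finset.mem_union, Finset.mem_filter]
    tauto
  have := Finset.card_le_card hcover
  have := Finset.card_union_le (E.filter fun i => Top i)
      ((E.filter fun i => ¬ Top i ∧ lineY (L i) (w i).1 < (w i).2) ∪
       (E.filter fun i => ¬ Top i ∧ ¬ lineY (L i) (w i).1 < (w i).2))
  have := Finset.card_union_le (E.filter fun i => ¬ Top i ∧ lineY (L i) (w i).1 < (w i).2)
       (E.filter fun i => ¬ Top i ∧ ¬ lineY (L i) (w i).1 < (w i).2)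
  omega

theorem sample_weight {α : Type*} [DecidableEq α] (Q A : Finset α) (hA : A ⊆ Q) (p q : ℝ)
    (hpq : p + q = 1) :
    ∑ S ∈ Q.powerset, (p ^ S.card * q ^ (Q \ S).card) * (if A ⊆ S then 1 else 0) = p ^ A.card := by
  have h := Finset.prod_add (fun _ : α => p) (fun i => if i ∈ A then 0 else q) Q
  have hL : ∏ i ∈ Q, (p + if i ∈ A then 0 else q) = p ^ A.card := by
    have : ∀ i ∈ Q, (p + if i ∈ A then 0 else q) = if i ∈ A then p else 1 := by
      intro i _
      split_ifs <;> simp [hpq]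
    rw [Finset.prod_congr rfl this, Finset.prod_ite, Finset.prod_const, Finset.prod_const_one,
      mul_one, Finset.filter_mem_eq_inter, Finset.inter_eq_right.2 hA]
  rw [← hL, h]
  apply Finset.sum_congr rfl
  intro S hS
  rw [Finset.prod_const, mul_assoc]
  congr 1
  by_cases hAS : A ⊆ S
  · rw [if_pos hAS, mul_one, ← Finset.prod_const]
    apply Finset.prod_congr rfl
    intro i hi
    rw [if_neg]
    intro hiA
    exact (Finset.mem_sdiff.1 hi).2 (hAS hiA)
  · rw [if_neg hAS, mul_zero]
    obtain ⟨i, hi1, hi2⟩ := Finset.not_subset.1 hAS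
    symm
    apply Finset.prod_eq_zero (Finset.mem_sdiff.2 ⟨hA hi1, hi2⟩)
    simp [hi1]

theorem sample_count {α τ : Type*} [DecidableEq α] (Q : Finset α) (T : Finset τ)
    (A : τ → Finset α) (k : ℕ) (hA : ∀ t ∈ T, A t ⊆ Q) (hk : ∀ t ∈ T, (A t).card = k) (p q : ℝ)
    (hpq : p + q = 1) :
    ∑ S ∈ Q.powerset, (p ^ S.card * q ^ (Q \ S).card) * ((T.filter fun t => A t ⊆ S).card : ℝ)
      = T.card * p ^ k := by
  have h1 : ∀ S ∈ Q.powerset,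
      (p ^ S.card * q ^ (Q \ S).card) * ((T.filter fun t => A t ⊆ S).card : ℝ)
      = ∑ t ∈ T, (p ^ S.card * q ^ (Q \ S).card) * (if A t ⊆ S then 1 else 0) := by
    intro S _
    rw [← Finset.mul_sum, Finset.card_filter]
    push_cast
    rfl
  rw [Finset.sum_congr rfl h1, Finset.sum_comm]
  rw [Finset.sum_congr rfl (fun t ht => sample_weight Q (A t) (hA t ht) p q hpq)]
  rw [Finset.sum_congr rfl (fun t ht => by rw [hk t ht]), Finset.sum_const, nsmul_eq_mul]

theorem crossing_sample {ι : Type*} (E : Finset ι) (Q : Finset (ℝ × ℝ))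
    (hS : Set.InjOn Prod.fst (Q : Set (ℝ × ℝ))) (L l r : ι → ℝ × ℝ)
    (hl : ∀ i ∈ E, l i ∈ Q) (hr : ∀ i ∈ E, r i ∈ Q)
    (hlt : ∀ i ∈ E, (l i).1 < (r i).1)
    (hlL : ∀ i ∈ E, (l i).2 = lineY (L i) (l i).1)
    (hrL : ∀ i ∈ E, (r i).2 = lineY (L i) (r i).1)
    (C : Finset (ι × ι)) (hCE : ∀ c ∈ C, c.1 ∈ E ∧ c.2 ∈ E)
    (hC4 : ∀ c ∈ C, ({l c.1, r c.1, l c.2, r c.2} : Finset (ℝ × ℝ)).card = 4)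
    (hC : ∀ i ∈ E, ∀ j ∈ E, i ≠ j → ∀ x, (l i).1 < x → x < (r i).1 → (l j).1 < x →
      x < (r j).1 → lineY (L i) x = lineY (L j) x → (i, j) ∈ C)
    (p : ℝ) (hp0 : 0 ≤ p) (hp1 : p ≤ 1) :
    (E.card : ℝ) * p ^ 2 ≤ 3 * (Q.card * p) + C.card * p ^ 4 := by
  classical
  have key : ∀ S ∈ Q.powerset,
      (E.filter fun i => ({l i, r i} : Finset (ℝ × ℝ)) ⊆ S).card ≤
      3 * (Q.filter fun s => ({s} : Finset (ℝ × ℝ)) ⊆ S).card +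
      (C.filter fun c => ({l c.1, r c.1, l c.2, r c.2} : Finset (ℝ × ℝ)) ⊆ S).card := by
    intro S hSQ
    rw [Finset.mem_powerset] at hSQ
    have e1 : (Q.filter fun s => ({s} : Finset (ℝ × ℝ)) ⊆ S) = S := by
      ext s
      simp only [Finset.mem_filter, Finset.singleton_subset_iff]
      exact ⟨fun h => h.2, fun h => ⟨hSQ h, h⟩⟩
    rw [e1]
    set ES := E.filter fun i => ({l i, r i} : Finset (ℝ × ℝ)) ⊆ S with hES
    set CS := C.filter fun c => ({l c.1, r c.1, l c.2, r c.2} : Finset (ℝ × ℝ)) ⊆ S with hCS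
    have hmem : ∀ i, i ∈ ES ↔ i ∈ E ∧ l i ∈ S ∧ r i ∈ S := by
      intro i
      simp [hES, Finset.insert_subset_iff]
    have hsub : ∀ i, i ∈ ES \ CS.image Prod.fst → i ∈ E ∧ l i ∈ S ∧ r i ∈ S := by
      intro i hi
      exact (hmem i).1 (Finset.mem_sdiff.1 hi).1
    have hpl : (ES \ CS.image Prod.fst).card ≤ 3 * S.card := by
      refine planar_bound _ S (hS.mono (by exact_mod_cast hSQ)) L l r (fun i hi => (hsub i hi).2.1)
        (fun i hi => (hsub i hi).2.2) (fun i hi => hlt i (hsub i hi).1)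
        (fun i hi => hlL i (hsub i hi).1) (fun i hi => hrL i (hsub i hi).1) ?_
      intro i hi j hj hij x h1 h2 h3 h4 h5
      have hi' := hsub i hi
      have hj' := hsub j hj
      have hc := hC i hi'.1 j hj'.1 hij x h1 h2 h3 h4 h5
      apply (Finset.mem_sdiff.1 hi).2
      rw [Finset.mem_image]
      refine ⟨(i, j), ?_, rfl⟩
      rw [hCS, Finset.mem_filter]
      refine ⟨hc, ?_⟩
      simp [Finset.insert_subset_iff, hi', hj']
    have h1 : (CS.image Prod.fst).card ≤ CS.card := Finset.card_image_le
    have h2 := Finset.le_card_sdiff (CS.image Prod.fst) ES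
    omega
  have hq : p + (1 - p) = 1 := by ring
  have s1 := sample_count Q E (fun i => ({l i, r i} : Finset (ℝ × ℝ))) 2
    (by intro i hi; simp [Finset.insert_subset_iff, hl i hi, hr i hi])
    (by
      intro i hi
      apply Finset.card_pair
      intro h
      have := hlt i hi
      rw [h] at this
      exact lt_irrefl _ this) p (1 - p) hq
  have s2 := sample_count Q Q (fun s => ({s} : Finset (ℝ × ℝ))) 1
    (by intro i hi; simpa using hi) (by intro i hi; simp) p (1 - p) hq
  have s3 := sample_count Q C (fun c => ({l c.1, r c.1, l c.2, r c.2} : Finset (ℝ × ℝ))) 4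
    (by
      intro c hc
      have := hCE c hc
      simp [Finset.insert_subset_iff, hl _ this.1, hl _ this.2, hr _ this.1, hr _ this.2])
    hC4 p (1 - p) hq
  rw [pow_one] at s2
  rw [← s1, ← s2, ← s3, Finset.mul_sum, ← Finset.sum_add_distrib]
  apply Finset.sum_le_sum
  intro S hS'
  have hk : ((E.filter fun i => ({l i, r i} : Finset (ℝ × ℝ)) ⊆ S).card : ℝ) ≤
      3 * ((Q.filter fun s => ({s} : Finset (ℝ × ℝ)) ⊆ S).card : ℝ) +
      ((C.filter fun c => ({l c.1, r c.1, l c.2, r c.2} : Finset (ℝ × ℝ)) ⊆ S).card : ℝ) := by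
    exact_mod_cast key S hS'
  have hw : 0 ≤ p ^ S.card * (1 - p) ^ (Q \ S).card :=
    mul_nonneg (pow_nonneg hp0 _) (pow_nonneg (by linarith) _)
  have := mul_le_mul_of_nonneg_left hk hw
  linarith

/-- The points of `Q` on the line `L`. -/
noncomputable def ptsOn (Q : Finset (ℝ × ℝ)) (L : ℝ × ℝ) : Finset (ℝ × ℝ) :=
  Q.filter fun p => p.2 = lineY L p.1

theorem mem_ptsOn {Q : Finset (ℝ × ℝ)} {L p : ℝ × ℝ} :
    p ∈ ptsOn Q L ↔ p ∈ Q ∧ p.2 = lineY L p.1 := by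
  simp [ptsOn]

theorem lineY_two {A B : ℝ × ℝ} {x y : ℝ} (hx : lineY A x = lineY B x)
    (hy : lineY A y = lineY B y) (hxy : x ≠ y) : A = B := by
  unfold lineY at *
  have h1 : (A.1 - B.1) * (x - y) = 0 := by linear_combination hx - hy
  have h2 : A.1 - B.1 = 0 := by
    rcases mul_eq_zero.1 h1 with h | h
    · exact h
    · exact absurd (sub_eq_zero.1 h) hxy
  have h3 : A.1 = B.1 := by linarith
  refine Prod.ext h3 ?_
  rw [h3] at hx
  linarith

theorem rich_lines_aux (Q : Finset (ℝ × ℝ)) (hS : Set.InjOn Prod.fst (Q : Set (ℝ × ℝ)))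
    (M : Finset (ℝ × ℝ)) (k : ℕ) (hM : ∀ L ∈ M, k ≤ (ptsOn Q L).card) :
    ∃ e : ℝ, (M.card : ℝ) * (k - 1) ≤ e ∧ ∀ p : ℝ, 0 ≤ p → p ≤ 1 →
      e * p ^ 2 ≤ 3 * (Q.card * p) + (M.card : ℝ) ^ 2 * p ^ 4 := by
  classical
  have hnext : ∀ i : (ℝ × ℝ) × (ℝ × ℝ), (∃ q ∈ ptsOn Q i.1, i.2.1 < q.1) →
      ∃ q ∈ ptsOn Q i.1, i.2.1 < q.1 ∧ ∀ s ∈ ptsOn Q i.1, i.2.1 < s.1 → q.1 ≤ s.1 := by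
    rintro i ⟨q0, hq0, h0⟩
    obtain ⟨q, hq, hmin⟩ := Finset.exists_min_image
      ((ptsOn Q i.1).filter fun s => i.2.1 < s.1) (fun s => s.1)
      ⟨q0, Finset.mem_filter.2 ⟨hq0, h0⟩⟩
    rw [Finset.mem_filter] at hq
    exact ⟨q, hq.1, hq.2, fun s hs h => hmin s (Finset.mem_filter.2 ⟨hs, h⟩)⟩
  choose! r hr1 hr2 hr3 using hnext
  let E : Finset ((ℝ × ℝ) × (ℝ × ℝ)) :=
    (M ×ˢ Q).filter fun i => i.2 ∈ ptsOn Q i.1 ∧ ∃ q ∈ ptsOn Q i.1, i.2.1 < q.1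
  have hE : ∀ i, i ∈ E ↔ i.1 ∈ M ∧ i.2 ∈ ptsOn Q i.1 ∧ ∃ q ∈ ptsOn Q i.1, i.2.1 < q.1 := by
    intro i
    simp only [E, Finset.mem_filter, Finset.mem_product]
    constructor
    · rintro ⟨⟨h1, _⟩, h2, h3⟩
      exact ⟨h1, h2, h3⟩
    · rintro ⟨h1, h2, h3⟩
      exact ⟨⟨h1, (mem_ptsOn.1 h2).1⟩, h2, h3⟩
  let X : (ℝ × ℝ) × (ℝ × ℝ) → (ℝ × ℝ) × (ℝ × ℝ) → ℝ → Prop := fun i j x =>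
    i.2.1 < x ∧ x < (r i).1 ∧ j.2.1 < x ∧ x < (r j).1 ∧ lineY i.1 x = lineY j.1 x
  -- two edges on the same line above the same abscissa coincide
  have hsame : ∀ i ∈ E, ∀ j ∈ E, i.1 = j.1 → ∀ x, i.2.1 < x → x < (r i).1 → j.2.1 < x →
      x < (r j).1 → i = j := by
    intro i hi j hj hij x h1 h2 h3 h4
    have hi' := (hE i).1 hi
    have hj' := (hE j).1 hj
    refine Prod.ext hij ?_
    rcases lt_trichotomy i.2.1 j.2.1 with h | h | h
    · have := hr3 i hi'.2.2 j.2 (by rw [hij]; exact hj'.2.1) h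
      linarith
    · exact hS (mem_ptsOn.1 hi'.2.1).1 (mem_ptsOn.1 hj'.2.1).1 h
    · have := hr3 j hj'.2.2 i.2 (by rw [← hij]; exact hi'.2.1) h
      linarith
  let C : Finset (((ℝ × ℝ) × (ℝ × ℝ)) × ((ℝ × ℝ) × (ℝ × ℝ))) :=
    (E ×ˢ E).filter fun c => c.1 ≠ c.2 ∧ ∃ x, X c.1 c.2 x
  have hCm : ∀ c, c ∈ C ↔ (c.1 ∈ E ∧ c.2 ∈ E) ∧ c.1 ≠ c.2 ∧ ∃ x, X c.1 c.2 x := by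
    intro c
    simp only [C, Finset.mem_filter, Finset.mem_product]
  have hCline : ∀ c ∈ C, c.1.1 ≠ c.2.1 := by
    intro c hc h
    obtain ⟨⟨h1, h2⟩, h3, x, x1, x2, x3, x4, x5⟩ := (hCm c).1 hc
    exact h3 (hsame _ h1 _ h2 h x x1 x2 x3 x4)
  have hCcard : C.card ≤ M.card ^ 2 := by
    have : C.card ≤ (M ×ˢ M).card := by
      apply Finset.card_le_card_of_injOn (fun c => (c.1.1, c.2.1))
      · intro c hc
        have hc := (hCm c).1 hc
        exact Finset.mem_coe.2 (Finset.mem_product.2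
          ⟨((hE _).1 hc.1.1).1, ((hE _).1 hc.1.2).1⟩)
      · intro c hc d hd hcd
        have hne := hCline c hc
        obtain ⟨⟨h1, h2⟩, h3, x, x1, x2, x3, x4, x5⟩ := (hCm c).1 hc
        obtain ⟨⟨g1, g2⟩, g3, y, y1, y2, y3, y4, y5⟩ := (hCm d).1 hd
        simp only [Prod.mk.injEq] at hcd
        have hxy : x = y := by
          by_contra hxy
          rw [← hcd.1, ← hcd.2] at y5
          exact hne (lineY_two x5 y5 hxy)
        subst hxy
        exact Prod.ext (hsame _ h1 _ g1 hcd.1 x x1 x2 y1 y2)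
          (hsame _ h2 _ g2 hcd.2 x x3 x4 y3 y4)
    rw [Finset.card_product] at this
    rw [sq]
    exact this
  have hEcard : (M.card : ℝ) * (k - 1) ≤ E.card := by
    have h1 : E.card = ∑ L ∈ M, (E.filter fun i => i.1 = L).card :=
      Finset.card_eq_sum_card_fiberwise (fun i hi => ((hE i).1 hi).1)
    rw [h1]
    push_cast
    rw [← nsmul_eq_mul, ← Finset.sum_const]
    apply Finset.sum_le_sum
    intro L hL
    have h2 : (ptsOn Q L).card ≤ (E.filter fun i => i.1 = L).card + 1 := by
      have h3 : ((ptsOn Q L).filter fun p => ∃ q ∈ ptsOn Q L, p.1 < q.1).card ≤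
          (E.filter fun i => i.1 = L).card := by
        apply Finset.card_le_card_of_injOn (fun p => (L, p))
        · intro p hp
          have hp := Finset.mem_filter.1 hp
          exact Finset.mem_coe.2 (Finset.mem_filter.2 ⟨(hE _).2 ⟨hL, hp.1, hp.2⟩, rfl⟩)
        · intro p _ q _ h
          exact (Prod.mk.inj h).2
      have h4 : ((ptsOn Q L).filter fun p => ¬ ∃ q ∈ ptsOn Q L, p.1 < q.1).card ≤ 1 := by
        rw [Finset.card_le_one]
        intro a ha b hb
        rw [Finset.mem_filter] at ha hb
        have ha2 := ha.2
        have hb2 := hb.2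
        push Not at ha2 hb2
        exact hS (mem_ptsOn.1 ha.1).1 (mem_ptsOn.1 hb.1).1
          (le_antisymm (hb2 a ha.1) (ha2 b hb.1))
      have h5 := Finset.card_filter_add_card_filter_not (s := ptsOn Q L)
        (fun p => ∃ q ∈ ptsOn Q L, p.1 < q.1)
      omega
    have h6 : (k : ℝ) ≤ (E.filter fun i => i.1 = L).card + 1 := by
      exact_mod_cast (hM L hL).trans h2
    linarith
  refine ⟨E.card, hEcard, ?_⟩
  intro p hp0 hp1
  have hmain := crossing_sample E Q hS (fun i => i.1) (fun i => i.2) r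
    (fun i hi => (mem_ptsOn.1 ((hE i).1 hi).2.1).1)
    (fun i hi => (mem_ptsOn.1 (hr1 i ((hE i).1 hi).2.2)).1)
    (fun i hi => hr2 i ((hE i).1 hi).2.2)
    (fun i hi => (mem_ptsOn.1 ((hE i).1 hi).2.1).2)
    (fun i hi => (mem_ptsOn.1 (hr1 i ((hE i).1 hi).2.2)).2)
    C (fun c hc => ((hCm c).1 hc).1) ?_ ?_ p hp0 hp1
  · have : (C.card : ℝ) ≤ (M.card : ℝ) ^ 2 := by exact_mod_cast hCcard
    have := mul_le_mul_of_nonneg_right this (pow_nonneg hp0 4)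
    linarith
  · intro c hc
    have hne := hCline c hc
    obtain ⟨⟨h1, h2⟩, h3, x, x1, x2, x3, x4, x5⟩ := (hCm c).1 hc
    have a1 := (mem_ptsOn.1 ((hE _).1 h1).2.1).2
    have a2 := (mem_ptsOn.1 (hr1 _ ((hE _).1 h1).2.2)).2
    have b1 := (mem_ptsOn.1 ((hE _).1 h2).2.1).2
    have b2 := (mem_ptsOn.1 (hr1 _ ((hE _).1 h2).2.2)).2
    have hz : ∀ z w : ℝ × ℝ, z.2 = lineY c.1.1 z.1 → w.2 = lineY c.2.1 w.1 → z.1 ≠ x →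
        z ≠ w := by
      intro z w hz1 hw1 hzx hzw
      subst hzw
      exact hne (lineY_two (hz1.symm.trans hw1) x5 hzx)
    have n1 : c.1.2 ≠ r c.1 := by
      intro h
      have : c.1.2.1 < (r c.1).1 := x1.trans x2
      rw [← h] at this
      exact lt_irrefl _ this
    have n2 : c.2.2 ≠ r c.2 := by
      intro h
      have : c.2.2.1 < (r c.2).1 := x3.trans x4
      rw [← h] at this
      exact lt_irrefl _ this
    have n3 := hz _ _ a1 b1 x1.ne
    have n4 := hz _ _ a1 b2 x1.ne
    have n5 := hz _ _ a2 b1 x2.ne'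
    have n6 := hz _ _ a2 b2 x2.ne'
    rw [Finset.card_insert_of_notMem (by simp [n1, n3, n4]),
      Finset.card_insert_of_notMem (by simp [n5, n6]), Finset.card_pair n2]
  · intro i hi j hj hij x h1 h2 h3 h4 h5
    exact (hCm _).2 ⟨⟨hi, hj⟩, hij, x, h1, h2, h3, h4, h5⟩

theorem rich_lines (Q : Finset (ℝ × ℝ)) (hS : Set.InjOn Prod.fst (Q : Set (ℝ × ℝ)))
    (M : Finset (ℝ × ℝ)) (k : ℕ) (hk : 2 ≤ k) (hM : ∀ L ∈ M, k ≤ (ptsOn Q L).card) :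
    (M.card : ℝ) * (k : ℝ) ^ 2 ≤ 576 * (Q.card : ℝ) ^ 2 / k + 12 * Q.card * k := by
  obtain ⟨e, he, hp⟩ := rich_lines_aux Q hS M k hM
  have hk' : (2 : ℝ) ≤ k := by exact_mod_cast hk
  set m : ℝ := (M.card : ℝ) with hm
  set n : ℝ := (Q.card : ℝ) with hn
  set κ : ℝ := (k : ℝ) with hκ
  have hm0 : 0 ≤ m := by positivity
  have hn0 : 0 ≤ n := by positivity
  have he' : m * κ / 2 ≤ e := by nlinarith
  have hpos : 0 ≤ 576 * n ^ 2 / κ := by positivity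
  by_cases hc : e ≤ 6 * n
  · have : m * κ ≤ 12 * n := by linarith
    nlinarith
  · push Not at hc
    have he0 : 0 < e := by linarith
    have h1 := hp (6 * n / e) (by positivity) (by rw [div_le_one he0]; linarith)
    have h2 : n * e ^ 3 * n ≤ 72 * n ^ 2 * m ^ 2 * n ^ 2 := by
      have e1 : e * (6 * n / e) ^ 2 = 36 * n ^ 2 * e ^ 3 / e ^ 4 := by field_simp; ring
      have e2 : 3 * (n * (6 * n / e)) + m ^ 2 * (6 * n / e) ^ 4 =
        (18 * n ^ 2 * e ^ 3 + 1296 * m ^ 2 * n ^ 4) / e ^ 4 := by field_simp; ring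
      rw [e1, e2, div_le_div_iff_of_pos_right (by positivity)] at h1
      nlinarith
    by_cases hn1 : n = 0
    · have hQ : Q = ∅ := by
        rw [← Finset.card_eq_zero]
        rw [hn] at hn1
        exact_mod_cast hn1
      have hM0 : M = ∅ := by
        rw [Finset.eq_empty_iff_forall_notMem]
        intro L hL
        have := hM L hL
        rw [hQ] at this
        simp [ptsOn] at this
        omega
      have : m = 0 := by rw [hm, hM0]; simp
      rw [this, hn1]
      simp
    · have hnp : 0 < n := lt_of_le_of_ne hn0 (Ne.symm hn1)
      have h3 : e ^ 3 ≤ 72 * n ^ 2 * m ^ 2 := by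
        have : n ^ 2 * e ^ 3 ≤ n ^ 2 * (72 * n ^ 2 * m ^ 2) := by nlinarith
        exact le_of_mul_le_mul_left this (by positivity)
      have h4 : (m * κ / 2) ^ 3 ≤ e ^ 3 := pow_le_pow_left₀ (by positivity) he' 3
      have h5 : m * κ ^ 2 ≤ 576 * n ^ 2 / κ := by
        rw [le_div_iff₀ (by linarith)]
        rcases hm0.eq_or_lt with hm1 | hm1
        · rw [← hm1]
          simp
          positivity
        · have : m ^ 2 * (m * κ ^ 2 * κ) ≤ m ^ 2 * (576 * n ^ 2) := by nlinarith
          exact le_of_mul_le_mul_left this (by positivity)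
      have : 0 ≤ 12 * n * κ := by positivity
      linarith

theorem geom_half (a b : ℕ) : ∑ i ∈ Finset.Ico a b, 1 / (2 : ℝ) ^ i ≤ 2 / 2 ^ a := by
  rcases le_total a b with h | h
  · have : ∑ i ∈ Finset.Ico a b, 1 / (2 : ℝ) ^ i = 2 / 2 ^ a - 2 / 2 ^ b := by
      induction b, h using Nat.le_induction with
      | base => simp
      | succ b hab ih =>
        rw [Finset.sum_Ico_succ_top hab, ih, pow_succ]
        field_simp
        ring
    rw [this]
    have : (0 : ℝ) ≤ 2 / 2 ^ b := by positivity
    linarith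
  · rw [Finset.Ico_eq_empty_of_le h]
    rw [Finset.sum_empty]
    positivity

theorem geom_two (a b : ℕ) : ∑ i ∈ Finset.Ico a b, (2 : ℝ) ^ i ≤ 2 ^ b := by
  rcases le_total a b with h | h
  · have : ∑ i ∈ Finset.Ico a b, (2 : ℝ) ^ i = 2 ^ b - 2 ^ a := by
      induction b, h using Nat.le_induction with
      | base => simp
      | succ b hab ih =>
        rw [Finset.sum_Ico_succ_top hab, ih, pow_succ]
        ring
    rw [this]
    have : (0 : ℝ) ≤ 2 ^ a := by positivity
    linarith
  · rw [Finset.Ico_eq_empty_of_le h]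
    simp

theorem rich_sum (Q : Finset (ℝ × ℝ)) (hS : Set.InjOn Prod.fst (Q : Set (ℝ × ℝ)))
    (M : Finset (ℝ × ℝ)) (hM : ∀ L ∈ M, 2 ^ 15 ≤ (ptsOn Q L).card)
    (hM2 : ∀ L ∈ M, (ptsOn Q L).card ^ 2 ≤ Q.card) :
    ∑ L ∈ M, ((ptsOn Q L).card : ℝ) ^ 2 ≤
      4608 * (Q.card : ℝ) ^ 2 / 2 ^ 15 + 96 * Q.card * Real.sqrt Q.card := by
  classical
  by_cases hQ : Q.card = 0
  · have : M = ∅ := by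
      rw [Finset.eq_empty_iff_forall_notMem]
      intro L hL
      have h1 := hM L hL
      have h2 := hM2 L hL
      rw [hQ] at h2
      have : (ptsOn Q L).card = 0 := by
        by_contra h
        have := pow_pos (Nat.pos_of_ne_zero h) 2
        omega
      omega
    rw [this]
    simp
    positivity
  set I := Nat.log 2 (Nat.sqrt Q.card) with hI
  have h1 : ∀ L ∈ M, ((ptsOn Q L).card : ℝ) ^ 2 ≤ ∑ i ∈ Finset.Ico 15 (I + 1),
      if 2 ^ i ≤ (ptsOn Q L).card then 4 * ((2 : ℝ) ^ i) ^ 2 else 0 := by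
    intro L hL
    have hc := hM L hL
    have hc2 := hM2 L hL
    set c := (ptsOn Q L).card with hcdef
    have hc0 : c ≠ 0 := by
      intro h
      rw [h] at hc
      norm_num at hc
    have hj1 : 2 ^ Nat.log 2 c ≤ c := Nat.pow_log_le_self 2 hc0
    have hj2 : c < 2 ^ (Nat.log 2 c + 1) := Nat.lt_pow_succ_log_self (by norm_num) c
    have hmem : Nat.log 2 c ∈ Finset.Ico 15 (I + 1) := by
      rw [Finset.mem_Ico]
      constructor
      · exact Nat.le_log_of_pow_le (by norm_num) hc
      · apply Nat.lt_succ_of_le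
        apply Nat.log_mono_right
        rw [Nat.le_sqrt, ← sq]
        exact hc2
    have hs := Finset.single_le_sum (f := fun i => if 2 ^ i ≤ c then 4 * ((2 : ℝ) ^ i) ^ 2 else 0)
      (fun i _ => by
        show (0 : ℝ) ≤ if 2 ^ i ≤ c then 4 * ((2 : ℝ) ^ i) ^ 2 else 0
        split_ifs <;> positivity) hmem
    refine le_trans ?_ hs
    show (c : ℝ) ^ 2 ≤ if 2 ^ Nat.log 2 c ≤ c then 4 * ((2 : ℝ) ^ Nat.log 2 c) ^ 2 else 0
    rw [if_pos hj1]
    have h3 : (c : ℝ) ≤ 2 * 2 ^ Nat.log 2 c := by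
      have : (c : ℝ) ≤ 2 ^ (Nat.log 2 c + 1) := by exact_mod_cast hj2.le
      rw [pow_succ] at this
      linarith
    have h4 : (0 : ℝ) ≤ c := by positivity
    nlinarith
  refine (Finset.sum_le_sum h1).trans ?_
  rw [Finset.sum_comm]
  have h2 : ∀ i ∈ Finset.Ico 15 (I + 1),
      (∑ L ∈ M, if 2 ^ i ≤ (ptsOn Q L).card then 4 * ((2 : ℝ) ^ i) ^ 2 else 0) ≤
      2304 * (Q.card : ℝ) ^ 2 * (1 / 2 ^ i) + 48 * Q.card * 2 ^ i := by
    intro i hi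
    rw [Finset.mem_Ico] at hi
    rw [← Finset.sum_filter, Finset.sum_const, nsmul_eq_mul]
    have h2i : 2 ≤ 2 ^ i := by
      calc 2 = 2 ^ 1 := by norm_num
        _ ≤ 2 ^ i := Nat.pow_le_pow_right (by norm_num) (by omega)
    have := rich_lines Q hS (M.filter fun L => 2 ^ i ≤ (ptsOn Q L).card) (2 ^ i) h2i
      (fun L hL => (Finset.mem_filter.1 hL).2)
    push_cast at this
    have e : 2304 * (Q.card : ℝ) ^ 2 * (1 / 2 ^ i) = 4 * (576 * (Q.card : ℝ) ^ 2 / 2 ^ i) := by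
      ring
    rw [e]
    linarith
  refine (Finset.sum_le_sum h2).trans ?_
  rw [Finset.sum_add_distrib, ← Finset.mul_sum, ← Finset.mul_sum]
  have g1 := geom_half 15 (I + 1)
  have g2 := geom_two 15 (I + 1)
  have g3 : (2 : ℝ) ^ (I + 1) ≤ 2 * Real.sqrt Q.card := by
    rw [pow_succ, mul_comm]
    apply mul_le_mul_of_nonneg_left _ (by norm_num)
    apply Real.le_sqrt_of_sq_le
    have : (2 ^ I) ^ 2 ≤ Q.card := by
      have h5 : 2 ^ I ≤ Nat.sqrt Q.card := by
        apply Nat.pow_log_le_self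
        intro h
        rw [Nat.sqrt_eq_zero] at h
        exact hQ h
      calc (2 ^ I) ^ 2 ≤ (Nat.sqrt Q.card) ^ 2 := Nat.pow_le_pow_left h5 2
        _ ≤ Q.card := Nat.sqrt_le' _
    exact_mod_cast this
  have k1 := mul_le_mul_of_nonneg_left g1 (show (0 : ℝ) ≤ 2304 * (Q.card : ℝ) ^ 2 by positivity)
  have k2 := mul_le_mul_of_nonneg_left (g2.trans g3) (show (0 : ℝ) ≤ 48 * (Q.card : ℝ) by positivity)
  have e1 : 2304 * (Q.card : ℝ) ^ 2 * (2 / 2 ^ 15) = 4608 * (Q.card : ℝ) ^ 2 / 2 ^ 15 := by ring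
  linarith

/-- The (slope, intercept) pair of the line through two points. -/
noncomputable def lin (p q : ℝ × ℝ) : ℝ × ℝ :=
  ((q.2 - p.2) / (q.1 - p.1), p.2 - (q.2 - p.2) / (q.1 - p.1) * p.1)

theorem lin_left (p q : ℝ × ℝ) : p.2 = lineY (lin p q) p.1 := by
  simp [lin, lineY]

theorem lin_right (p q : ℝ × ℝ) (h : p.1 ≠ q.1) : q.2 = lineY (lin p q) q.1 := by
  have : q.1 - p.1 ≠ 0 := sub_ne_zero.2 h.symm
  simp only [lin, lineY]
  field_simp
  ring

theorem generic_case (Q : Finset (ℝ × ℝ)) (hS : Set.InjOn Prod.fst (Q : Set (ℝ × ℝ)))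
    (hQ2 : 2 ≤ Q.card) (hQ : ∀ L, (ptsOn Q L).card ^ 2 ≤ Q.card) :
    ∃ α ∈ Q, ∃ B : Finset (ℝ × ℝ), Q.card ≤ 2359296 * B.card ∧
      ∀ L ∈ B, α ∈ ptsOn Q L ∧ ∃ β ∈ Q, β ≠ α ∧ β ∈ ptsOn Q L := by
  classical
  have hlin : ∀ p ∈ Q, ∀ q ∈ Q, p ≠ q → p ∈ ptsOn Q (lin p q) ∧ q ∈ ptsOn Q (lin p q) := by
    intro p hp q hq hpq
    refine ⟨mem_ptsOn.2 ⟨hp, lin_left p q⟩, mem_ptsOn.2 ⟨hq, lin_right p q ?_⟩⟩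
    intro h
    exact hpq (hS hp hq h)
  by_cases hn : Q.card < 2359296
  · obtain ⟨a, ha, b, hb, hab⟩ := Finset.one_lt_card.1 (show 1 < Q.card by omega)
    refine ⟨a, ha, {lin a b}, by simp; omega, ?_⟩
    intro L hL
    rw [Finset.mem_singleton] at hL
    subst hL
    have := hlin a ha b hb hab
    exact ⟨this.1, b, hb, hab.symm, this.2⟩
  push Not at hn
  obtain ⟨T, hT⟩ : ∃ T : ℕ, T = 2 ^ 15 := ⟨_, rfl⟩
  set R := Q.offDiag.filter fun c => T ≤ (ptsOn Q (lin c.1 c.2)).card with hR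
  set P := Q.offDiag.filter fun c => ¬ T ≤ (ptsOn Q (lin c.1 c.2)).card with hP
  have hRP : R.card + P.card = Q.card * Q.card - Q.card := by
    rw [hR, hP, Finset.card_filter_add_card_filter_not, Finset.offDiag_card]
  have hRcard : (R.card : ℝ) ≤ 4608 * (Q.card : ℝ) ^ 2 / 2 ^ 15 + 96 * Q.card * Real.sqrt Q.card := by
    refine le_trans ?_ (rich_sum Q hS (R.image fun c => lin c.1 c.2) ?_ (fun L _ => hQ L))
    · have h1 := Finset.card_eq_sum_card_image (fun c : (ℝ × ℝ) × (ℝ × ℝ) => lin c.1 c.2) R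
      rw [h1]
      push_cast
      apply Finset.sum_le_sum
      intro L _
      have h2 : (R.filter fun c => lin c.1 c.2 = L) ⊆ ptsOn Q L ×ˢ ptsOn Q L := by
        intro c hc
        rw [Finset.mem_filter, hR, Finset.mem_filter, Finset.mem_offDiag] at hc
        have := hlin c.1 hc.1.1.1 c.2 hc.1.1.2.1 hc.1.1.2.2
        rw [hc.2] at this
        exact Finset.mem_product.2 this
      have h3 := Finset.card_le_card h2
      rw [Finset.card_product, ← sq] at h3
      exact_mod_cast h3
    · intro L hL
      rw [Finset.mem_image] at hL
      obtain ⟨c, hc, rfl⟩ := hL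
      rw [← hT]
      exact (Finset.mem_filter.1 hc).2
  have hn' : (2359296 : ℝ) ≤ Q.card := by exact_mod_cast hn
  have hsq : 1536 * Real.sqrt Q.card ≤ Q.card := by
    have h1 : (1536 : ℝ) ≤ Real.sqrt Q.card := by
      apply Real.le_sqrt_of_sq_le
      norm_num
      exact hn
    have h2 := Real.mul_self_sqrt (show (0 : ℝ) ≤ Q.card by positivity)
    nlinarith
  have hPcard : (Q.card : ℝ) * Q.card ≤ 2 * P.card := by
    have h1 : R.card + P.card + Q.card = Q.card * Q.card := by
      have : Q.card ≤ Q.card * Q.card := Nat.le_mul_self _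
      omega
    have h2 : (R.card : ℝ) + P.card + Q.card = Q.card * Q.card := by exact_mod_cast h1
    nlinarith
  have hfib : ∃ α ∈ Q, Q.card ≤ 2 * (P.filter fun c => c.1 = α).card := by
    by_contra hcon
    push Not at hcon
    have h1 := Finset.card_eq_sum_card_fiberwise (s := P) (f := fun c => c.1) (t := Q)
      (fun c hc => (Finset.mem_offDiag.1 (Finset.mem_filter.1 hc).1).1)
    have h2 : ∑ α ∈ Q, 2 * (P.filter fun c => c.1 = α).card < ∑ α ∈ Q, Q.card := by
      apply Finset.sum_lt_sum_of_nonempty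
      · rw [← Finset.card_pos]
        omega
      · exact hcon
    rw [← Finset.mul_sum, ← h1, Finset.sum_const, smul_eq_mul] at h2
    have h3 : Q.card * Q.card ≤ 2 * P.card := by exact_mod_cast hPcard
    omega
  obtain ⟨α, hα, hαc⟩ := hfib
  refine ⟨α, hα, (P.filter fun c => c.1 = α).image fun c => lin c.1 c.2, ?_, ?_⟩
  · have h1 := Finset.card_le_mul_card_image (f := fun c : (ℝ × ℝ) × (ℝ × ℝ) => lin c.1 c.2)
      (P.filter fun c => c.1 = α) T (by
      intro L hL
      rw [Finset.mem_image] at hL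
      obtain ⟨d, hd, rfl⟩ := hL
      have hd' := Finset.mem_filter.1 hd
      have hd2 := (Finset.mem_filter.1 hd'.1).2
      refine le_trans ?_ (not_le.1 hd2).le
      apply Finset.card_le_card_of_injOn (fun c => c.2)
      · intro c hc
        have hc := Finset.mem_filter.1 hc
        have hc1 := Finset.mem_filter.1 hc.1
        have hc2 := Finset.mem_offDiag.1 (Finset.mem_filter.1 hc1.1).1
        have := (hlin c.1 hc2.1 c.2 hc2.2.1 hc2.2.2).2
        rw [hc.2] at this
        exact this
      · intro c hc e he hce
        have hc := (Finset.mem_filter.1 (Finset.mem_filter.1 hc).1).2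
        have he := (Finset.mem_filter.1 (Finset.mem_filter.1 he).1).2
        exact Prod.ext (hc.trans he.symm) hce)
    norm_num at hT
    subst hT
    omega
  · intro L hL
    rw [Finset.mem_image] at hL
    obtain ⟨c, hc, rfl⟩ := hL
    have hc' := Finset.mem_filter.1 hc
    have hc2 := Finset.mem_offDiag.1 (Finset.mem_filter.1 hc'.1).1
    have := hlin c.1 hc2.1 c.2 hc2.2.1 hc2.2.2
    rw [← hc'.2]
    exact ⟨this.1, c.2, hc2.2.1, hc2.2.2.symm, this.2⟩

theorem lines_finite (Q : Finset (ℝ × ℝ)) (α : ℝ × ℝ) :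
    {ℓ : Set (ℝ × ℝ) | IsLine ℓ ∧ α ∈ ℓ ∧ ∃ β ∈ Q, β ≠ α ∧ β ∈ ℓ}.Finite := by
  apply Set.Finite.subset ((Q.finite_toSet).image fun β : ℝ × ℝ =>
    {z : ℝ × ℝ | (β.1 - α.1) * (z.2 - α.2) = (β.2 - α.2) * (z.1 - α.1)})
  rintro ℓ ⟨⟨a, b, c, hab, rfl⟩, hα, β, hβ, hne, hβl⟩
  refine ⟨β, hβ, ?_⟩
  simp only [Set.mem_ofPred_eq] at hα hβl
  ext z
  simp only [Set.mem_ofPred_eq]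
  constructor
  · intro h
    have h1 : (β.1 - α.1) * (a * z.1 + b * z.2 - c) = 0 := by
      by_cases hb : b = 0
      · have ha : a ≠ 0 := by
          rintro rfl
          exact hab (by rw [hb])
        have : β.1 - α.1 = 0 := by
          apply mul_left_cancel₀ ha
          rw [hb] at hα hβl
          linarith
        rw [this, zero_mul]
      · linear_combination b * h + (z.1 - α.1) * (hβl - hα) + (β.1 - α.1) * hα
    have h2 : (β.2 - α.2) * (a * z.1 + b * z.2 - c) = 0 := by
      linear_combination (-a) * h + (z.2 - α.2) * (hβl - hα) + (β.2 - α.2) * hα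
    rcases mul_eq_zero.1 h1 with h3 | h3
    · rcases mul_eq_zero.1 h2 with h4 | h4
      · exact absurd (Prod.ext (by linarith) (by linarith)) hne
      · linarith
    · linarith
  · intro h
    have h1 : a * ((β.1 - α.1) * (z.2 - α.2) - (β.2 - α.2) * (z.1 - α.1)) = 0 := by
      linear_combination (z.2 - α.2) * (hβl - hα) - (β.2 - α.2) * (h - hα)
    have h2 : b * ((β.1 - α.1) * (z.2 - α.2) - (β.2 - α.2) * (z.1 - α.1)) = 0 := by
      linear_combination (-(z.1 - α.1)) * (hβl - hα) + (β.1 - α.1) * (h - hα)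
    rcases mul_eq_zero.1 h1 with h3 | h3
    · rcases mul_eq_zero.1 h2 with h4 | h4
      · exact absurd (by rw [h3, h4]) hab
      · linarith
    · linarith

theorem exists_shear (Q : Finset (ℝ × ℝ)) :
    ∃ t : ℝ, ∀ p ∈ Q, ∀ q ∈ Q, p.1 + t * p.2 = q.1 + t * q.2 → p = q := by
  classical
  obtain ⟨t, ht⟩ := Infinite.exists_notMem_finset
    ((Q ×ˢ Q).image fun c => -(c.1.1 - c.2.1) / (c.1.2 - c.2.2))
  refine ⟨t, ?_⟩
  intro p hp q hq h
  by_cases h2 : p.2 = q.2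
  · rw [h2] at h
    exact Prod.ext (by linarith) h2
  · exfalso
    apply ht
    rw [Finset.mem_image]
    refine ⟨(p, q), Finset.mem_product.2 ⟨hp, hq⟩, ?_⟩
    have : p.2 - q.2 ≠ 0 := sub_ne_zero.2 h2
    simp only
    rw [div_eq_iff this]
    linarith

/-- Many directions from a single point: if no line carries more than `√|Q|` points
of `Q`, then some `α ∈ Q` sees at least `|Q|/K` distinct lines through `α` and another
point of `Q`. -/
theorem many_directions_from_a_point :
    ∃ K : ℝ, 0 < K ∧
      ∀ Q : Finset (ℝ × ℝ), 2 ≤ Q.card →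
        (∀ ℓ : Set (ℝ × ℝ), IsLine ℓ →
          (((Q : Set (ℝ × ℝ)) ∩ ℓ).ncard : ℝ) ≤ Real.sqrt (Q.card : ℝ)) →
        ∃ α ∈ Q,
          (Q.card : ℝ) / K ≤
            ({ℓ : Set (ℝ × ℝ) | IsLine ℓ ∧ α ∈ ℓ ∧
              ∃ β ∈ Q, β ≠ α ∧ β ∈ ℓ}.ncard : ℝ) := by
  classical
  refine ⟨2359296, by norm_num, ?_⟩
  intro Q hQ2 hQ
  obtain ⟨t, ht⟩ := exists_shear Q
  let φ : ℝ × ℝ → ℝ × ℝ := fun p => (p.1 + t * p.2, p.2)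
  have hφ : Function.Injective φ := by
    intro p q h
    have h1 := (Prod.mk.inj h).1
    have h2 := (Prod.mk.inj h).2
    rw [h2] at h1
    exact Prod.ext (by linarith) h2
  let G : ℝ × ℝ → Set (ℝ × ℝ) := fun L => {p | (-L.1) * p.1 + (1 - L.1 * t) * p.2 = L.2}
  have hG : ∀ L p, p ∈ G L ↔ (φ p).2 = lineY L (φ p).1 := by
    intro L p
    simp only [G, φ, lineY, Set.mem_ofPred_eq]
    constructor <;> intro h <;> linarith
  have hGline : ∀ L, IsLine (G L) := by
    intro L
    refine ⟨-L.1, 1 - L.1 * t, L.2, ?_, rfl⟩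
    intro h
    have h1 := (Prod.mk.inj h).1
    have h2 := (Prod.mk.inj h).2
    have h3 : L.1 = 0 := by linarith
    rw [h3] at h2
    norm_num at h2
  have hGinj : Function.Injective G := by
    intro L L' h
    have hx : ∀ x, lineY L x = lineY L' x := by
      intro x
      have h1 : (x - t * lineY L x, lineY L x) ∈ G L := by
        rw [hG]
        simp [φ]
      rw [h, hG] at h1
      simpa [φ] using h1
    exact lineY_two (hx 0) (hx 1) (by norm_num)
  have hcard : (Q.image φ).card = Q.card := Finset.card_image_of_injective Q hφ
  obtain ⟨α', hα', B, hB, hBL⟩ := generic_case (Q.image φ) (by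
      intro p hp q hq h
      rw [Finset.mem_coe, Finset.mem_image] at hp hq
      obtain ⟨p, hp, rfl⟩ := hp
      obtain ⟨q, hq, rfl⟩ := hq
      rw [ht p hp q hq h]) (by rw [hcard]; exact hQ2) (by
      intro L
      have h1 := hQ (G L) (hGline L)
      have h2 : ptsOn (Q.image φ) L = (Q.filter fun p => p ∈ G L).image φ := by
        ext z
        rw [mem_ptsOn, Finset.mem_image, Finset.mem_image]
        constructor
        · rintro ⟨⟨p, hp, rfl⟩, h⟩
          exact ⟨p, Finset.mem_filter.2 ⟨hp, (hG L p).2 h⟩, rfl⟩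
        · rintro ⟨p, hp, rfl⟩
          have hp := Finset.mem_filter.1 hp
          exact ⟨⟨p, hp.1, rfl⟩, (hG L p).1 hp.2⟩
      have h3 : (Q : Set (ℝ × ℝ)) ∩ G L = ((Q.filter fun p => p ∈ G L : Finset (ℝ × ℝ)) :
          Set (ℝ × ℝ)) := by
        ext z
        simp
      rw [h3, Set.ncard_coe_finset] at h1
      rw [h2, Finset.card_image_of_injective _ hφ, hcard]
      have h4 := Real.sq_sqrt (show (0 : ℝ) ≤ Q.card by positivity)
      have h5 := pow_le_pow_left₀ (by positivity) h1 2
      rw [h4] at h5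
      exact_mod_cast h5)
  rw [Finset.mem_image] at hα'
  obtain ⟨α, hα, rfl⟩ := hα'
  refine ⟨α, hα, ?_⟩
  rw [hcard] at hB
  have hsub : G '' (B : Set (ℝ × ℝ)) ⊆ {ℓ : Set (ℝ × ℝ) | IsLine ℓ ∧ α ∈ ℓ ∧
              ∃ β ∈ Q, β ≠ α ∧ β ∈ ℓ} := by
    rintro _ ⟨L, hL, rfl⟩
    obtain ⟨h1, β', hβ', hne, h2⟩ := hBL L hL
    rw [Finset.mem_image] at hβ'
    obtain ⟨β, hβ, rfl⟩ := hβ'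
    refine ⟨hGline L, (hG L α).2 (mem_ptsOn.1 h1).2, β, hβ, ?_, (hG L β).2 (mem_ptsOn.1 h2).2⟩
    rintro rfl
    exact hne rfl
  have h6 := Set.ncard_le_ncard hsub (lines_finite Q α)
  rw [Set.ncard_image_of_injective _ hGinj, Set.ncard_coe_finset] at h6
  rw [div_le_iff₀ (by norm_num)]
  have h7 := hB.trans (Nat.mul_le_mul_left 2359296 h6)
  rw [mul_comm] at h7
  exact_mod_cast h7
end

section
/- (Inverse Loomis–Whitney example) For every positive integer k that is not a perfect square there exist constants c₁, c₂, C₂ > 0 such that for every integer p ≥ 1 there exists N₀(p) such that for all N ≥ N₀(p), setting P = A_N × A_N, there exists a finite set D ⊆ ℝ of slopes with |D| ≥ c₁·p such that for every s ∈ D the projection { y − s·x : (x,y) ∈ P } has size at least c₂·√p·N and at most C₂·√p·N. -/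
/-- `A_N = { x₁ + x₂·√k : x₁, x₂ ∈ ℤ, |x₁| ≤ √N, |x₂| ≤ √N }`. -/
def aSet (k N : ℕ) : Set ℝ :=
  {x : ℝ | ∃ x₁ x₂ : ℤ, |(x₁ : ℝ)| ≤ Real.sqrt N ∧ |(x₂ : ℝ)| ≤ Real.sqrt N ∧
    x = (x₁ : ℝ) + (x₂ : ℝ) * Real.sqrt k}


lemma ilw_root_count (l M : ℕ) [Fact l.Prime] (α β : ℤ) (hα : ¬ (l:ℤ) ∣ α) (c : ZMod l) :
    ((Finset.range M).filter (fun s : ℕ => (((α * s + β : ℤ)) : ZMod l)^2 = c)).card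
      ≤ 2 * (M / l + 1) := by
  classical
  by_cases hr : ∃ r : ZMod l, r^2 = c
  swap
  · rw [Finset.filter_false_of_mem]
    · simp
    · intro s _ h
      exact hr ⟨_, h⟩
  obtain ⟨r, rfl⟩ := hr
  have hα' : (α : ZMod l) ≠ 0 := by
    rwa [Ne, ZMod.intCast_zmod_eq_zero_iff_dvd]
  have hcard : ((Finset.univ : Finset Bool) ×ˢ Finset.range (M / l + 1)).card = 2 * (M/l+1) := by
    simp
  rw [← hcard]
  apply Finset.card_le_card_of_injOn
    (fun s : ℕ => (decide (((α * s + β : ℤ) : ZMod l) = r), s / l))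
  · intro s hs
    simp only [Finset.coe_filter, Finset.mem_range, Set.mem_ofPred_eq] at hs
    simp only [Finset.coe_product, Set.mem_prod, Finset.mem_coe, Finset.mem_univ, true_and,
      Finset.mem_range]
    exact Nat.lt_succ_of_le (Nat.div_le_div_right hs.1.le)
  · intro s hs s' hs' h
    simp only [Finset.coe_filter, Finset.mem_range, Set.mem_ofPred_eq] at hs hs'
    simp only [Prod.mk.injEq, decide_eq_decide] at h
    have h1 : ((α * s + β : ℤ) : ZMod l) = ((α * s' + β : ℤ) : ZMod l) := by
      rcases sq_eq_sq_iff_eq_or_eq_neg.1 hs.2 with h2 | h2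
      · rw [h2, h.1.1 h2]
      · rcases sq_eq_sq_iff_eq_or_eq_neg.1 hs'.2 with h3 | h3
        · rw [h3, h.1.2 h3]
        · rw [h2, h3]
    have h2 : ((s:ℕ) : ZMod l) = ((s':ℕ) : ZMod l) := by
      push_cast at h1
      exact mul_left_cancel₀ hα' (add_right_cancel h1)
    rw [ZMod.natCast_eq_natCast_iff'] at h2
    rw [← Nat.div_add_mod s l, ← Nat.div_add_mod s' l, h.2, h2]

lemma ilw_norm_count (k : ℤ) (l M : ℕ) (hl : l.Prime) (α β γ : ℤ) (hα : ¬ (l:ℤ) ∣ α) :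
    ((Finset.range M ×ˢ Finset.range M).filter
      (fun q : ℕ × ℕ => (l:ℤ) ∣ (α * q.1 + β)^2 - k * (γ * q.2)^2)).card
      ≤ M * (2 * (M / l + 1)) := by
  classical
  have := Fact.mk hl
  have h1 := Finset.card_le_mul_card_image_of_maps_to
    (s := (Finset.range M ×ˢ Finset.range M).filter
      (fun q : ℕ × ℕ => (l:ℤ) ∣ (α * q.1 + β)^2 - k * (γ * q.2)^2))
    (t := Finset.range M) (f := Prod.snd)
    (fun q hq => by
      simp only [Finset.mem_filter, Finset.mem_product] at hq
      exact hq.1.2) (2 * (M/l+1)) (fun t ht => ?_)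
  · rw [Finset.card_range] at h1
    linarith
  · refine le_trans ?_ (ilw_root_count l M α β hα ((k * (γ * t)^2 : ℤ) : ZMod l))
    apply Finset.card_le_card_of_injOn Prod.fst
    · intro q hq
      simp only [Finset.coe_filter, Finset.mem_filter, Finset.mem_product, Set.mem_ofPred_eq, Finset.mem_range] at hq ⊢
      obtain ⟨⟨⟨h1, h2⟩, h3⟩, rfl⟩ := hq
      refine ⟨h1, ?_⟩
      rw [← ZMod.intCast_zmod_eq_zero_iff_dvd] at h3
      push_cast at h3 ⊢
      linear_combination h3
    · intro q hq q' hq' h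
      simp only [Finset.coe_filter, Finset.mem_filter, Set.mem_ofPred_eq] at hq hq'
      exact Prod.ext h (hq.2.trans hq'.2.symm)

lemma ilw_large_primes (n M : ℕ) (hM : 0 < M) (hn : n ≠ 0) (h : n < M^3) :
    (n.primeFactors.filter (fun l => M < l)).card ≤ 2 := by
  have h1 : M ^ (n.primeFactors.filter (fun l => M < l)).card ≤ n := by
    calc M ^ (n.primeFactors.filter (fun l => M < l)).card
        ≤ ∏ l ∈ n.primeFactors.filter (fun l => M < l), l := by
          apply Finset.pow_card_le_prod
          intro l hl
          exact (Finset.mem_filter.1 hl).2.le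
      _ ≤ n := by
          apply Nat.le_of_dvd (Nat.pos_of_ne_zero hn)
          exact (Finset.prod_dvd_prod_of_subset _ _ _ (Finset.filter_subset _ _)).trans
            (Nat.prod_primeFactors_dvd n)
  have h2 := h1.trans_lt h
  by_contra! h3
  have := Nat.pow_le_pow_right hM (show 3 ≤ _ from h3)
  omega

def ilwA (k : ℕ) (q : ℕ × ℕ) : ℤ√(k:ℤ) := ⟨1 * q.1 + 1, 1 * q.2⟩

def ilwB (k L M : ℕ) (q : ℕ × ℕ) : ℤ√(k:ℤ) := ⟨L * q.1 + (8 * k * L * M + 1), L * q.2⟩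

lemma ilwA_norm (k : ℕ) (q : ℕ × ℕ) :
    (ilwA k q).norm = (1 * q.1 + 1)^2 - k * (1 * q.2)^2 := by
  simp only [ilwA, Zsqrtd.norm_def]; ring

lemma ilwB_norm (k L M : ℕ) (q : ℕ × ℕ) :
    (ilwB k L M q).norm = (L * q.1 + (8 * k * L * M + 1))^2 - k * (L * q.2)^2 := by
  simp only [ilwB, Zsqrtd.norm_def]; ring

lemma ilw_coprime (k : ℕ) (a b : ℤ√(k:ℤ)) (h : IsCoprime a.norm b.norm) : IsCoprime a b := by
  have h1 := h.map (Int.castRingHom (ℤ√(k:ℤ)))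
  simp only [eq_intCast, Zsqrtd.norm_eq_mul_conj] at h1
  exact h1.of_mul_left_left.of_mul_right_left

lemma ilw_nsq (k : ℕ) (hks : ¬ IsSquare k) (n : ℤ) : (k:ℤ) ≠ n * n := by
  intro h
  apply hks
  refine ⟨n.natAbs, ?_⟩
  zify
  rw [h, abs_mul_abs_self]

lemma ilw_norm_ne (k : ℕ) (hks : ¬ IsSquare k) (z : ℤ√(k:ℤ)) (hz : z ≠ 0) : z.norm ≠ 0 := by
  rwa [Ne, Zsqrtd.norm_eq_zero (ilw_nsq k hks)]

lemma ilwA_ne (k : ℕ) (q : ℕ × ℕ) : ilwA k q ≠ 0 := by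
  intro h
  have := congrArg Zsqrtd.re h
  simp only [ilwA, Zsqrtd.re_zero] at this
  omega

lemma ilw_good_count (k L M : ℕ) (hk : 0 < k) (hks : ¬ IsSquare k)
    (hL : ∀ l : ℕ, l.Prime → l ≤ 64 → l ∣ L) (hM : 64 ≤ M) (hkM : k < M) :
    ∃ G : Finset ((ℕ × ℕ) × (ℕ × ℕ)), M^4 ≤ 2 * G.card ∧ ∀ q ∈ G,
      q.1.1 < M ∧ q.1.2 < M ∧ q.2.1 < M ∧ q.2.2 < M ∧
      IsCoprime (ilwA k q.1) (ilwB k L M q.2) := by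
  classical
  set R := Finset.range M ×ˢ Finset.range M with hR
  have hRcard : R.card = M * M := by simp [hR]
  set Fa : ℕ → Finset (ℕ × ℕ) := fun l => R.filter (fun q => (l:ℤ) ∣ (ilwA k q).norm) with hFa
  set Fb : ℕ → Finset (ℕ × ℕ) := fun l => R.filter (fun q => (l:ℤ) ∣ (ilwB k L M q).norm) with hFb
  have ha : ∀ l : ℕ, l.Prime → (Fa l).card ≤ M * (2 * (M / l + 1)) := by
    intro l hl
    simp only [hFa, ilwA_norm]
    exact ilw_norm_count k l M hl 1 1 1 (by
      intro h; exact hl.one_lt.ne' (by exact_mod_cast Int.eq_one_of_dvd_one (by positivity) h))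
  have hb0 : ∀ l : ℕ, l.Prime → ∀ q, (l:ℤ) ∣ (ilwB k L M q).norm → ¬ (l:ℤ) ∣ (L:ℤ) := by
    intro l hl q h1 h2
    rw [ilwB_norm] at h1
    have h3 : (l:ℤ) ∣ 1 := by
      obtain ⟨c, hc⟩ := h2
      obtain ⟨e, he⟩ := h1
      rw [hc] at he
      refine ⟨e - (l*c^2*q.1^2 + 2 * c * q.1 * (8*k*(l*c)*M+1) + 64*k^2*c^2*l*M^2
        + 16 * k * c * M - k * l * c^2 * q.2^2), ?_⟩
      linear_combination he
    exact hl.one_lt.ne' (by exact_mod_cast Int.eq_one_of_dvd_one (by positivity) h3)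
  have hb : ∀ l : ℕ, l.Prime → (Fb l).card ≤ M * (2 * (M / l + 1)) := by
    intro l hl
    by_cases hd : (l:ℤ) ∣ (L:ℤ)
    · have : Fb l = ∅ := by
        apply Finset.filter_false_of_mem
        intro q _ h
        exact hb0 l hl q h hd
      simp [this]
    · simp only [hFb, ilwB_norm]
      exact ilw_norm_count k l M hl L (8 * k * L * M + 1) L hd
  set Bad1 := ((Finset.Ioc 64 M).filter Nat.Prime).biUnion (fun l => Fa l ×ˢ Fb l) with hBad1
  set Bad2 := R.biUnion (fun q => ({q} : Finset (ℕ × ℕ)) ×ˢ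
    (((ilwA k q).norm.natAbs.primeFactors.filter (fun l => M < l)).biUnion Fb)) with hBad2
  refine ⟨(R ×ˢ R) \ (Bad1 ∪ Bad2), ?_, ?_⟩
  · have c1 : 4 * Bad1.card ≤ M^4 := by
      have h1 : (Bad1.card : ℝ) ≤ ∑ l ∈ Finset.Ioc 64 M, 16 * (M:ℝ)^4 * (((l:ℝ)^2)⁻¹) := by
        calc (Bad1.card : ℝ) ≤ ((∑ l ∈ (Finset.Ioc 64 M).filter Nat.Prime,
                (Fa l ×ˢ Fb l).card : ℕ) : ℝ) := by
              exact_mod_cast Finset.card_biUnion_le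
          _ = ∑ l ∈ (Finset.Ioc 64 M).filter Nat.Prime, ((Fa l ×ˢ Fb l).card : ℝ) := by
              push_cast; rfl
          _ ≤ ∑ l ∈ (Finset.Ioc 64 M).filter Nat.Prime, 16 * (M:ℝ)^4 * (((l:ℝ)^2)⁻¹) := by
              apply Finset.sum_le_sum
              intro l hl
              simp only [Finset.mem_filter, Finset.mem_Ioc] at hl
              have hl0 : (0:ℝ) < l := by exact_mod_cast (by omega : 0 < l)
              have hdiv : ((M / l + 1 : ℕ) : ℝ) ≤ 2 * ((M:ℝ) / l) := by
                push_cast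
                have h1 : ((M / l : ℕ) : ℝ) ≤ (M:ℝ) / l := Nat.cast_div_le
                have h2 : 1 ≤ (M:ℝ) / l := by
                  rw [one_le_div hl0]; exact_mod_cast hl.1.2
                linarith
              have key : ∀ c : ℕ, c ≤ M * (2 * (M / l + 1)) → (c:ℝ) ≤ 4 * M^2 / l := by
                intro c hc
                have hc' : (c:ℝ) ≤ M * (2 * ((M / l + 1 : ℕ):ℝ)) := by exact_mod_cast hc
                calc (c:ℝ) ≤ M * (2 * ((M / l + 1 : ℕ):ℝ)) := hc'
                  _ ≤ M * (2 * (2 * ((M:ℝ) / l))) := by gcongr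
                  _ = 4 * M^2 / l := by ring
              rw [Finset.card_product]
              push_cast
              calc ((Fa l).card : ℝ) * (Fb l).card ≤ (4 * M^2 / l) * (4 * M^2 / l) := by
                    gcongr
                    · exact key _ (ha l hl.2)
                    · exact key _ (hb l hl.2)
                _ = 16 * (M:ℝ)^4 * (((l:ℝ)^2)⁻¹) := by field_simp; ring
          _ ≤ _ := by
              apply Finset.sum_le_sum_of_subset_of_nonneg (Finset.filter_subset _ _)
              intros; positivity
      rw [← Finset.mul_sum] at h1
      have h2 := sum_Ioc_inv_sq_le_sub (α := ℝ) (k := 64) (n := M) (by norm_num) hM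
      have h3 : (0:ℝ) ≤ (M:ℝ)⁻¹ := by positivity
      have h4 : (Bad1.card : ℝ) ≤ 16 * (M:ℝ)^4 * (1/64) := by
        refine h1.trans ?_
        gcongr
        push_cast at h2
        linarith
      have h5 : (4 * Bad1.card : ℝ) ≤ M^4 := by linarith
      exact_mod_cast h5
    have c2 : Bad2.card ≤ (M * M) * (4 * M) := by
      rw [← hRcard]
      apply Finset.card_biUnion_le_card_mul
      intro q hq
      rw [Finset.card_product, Finset.card_singleton, one_mul]
      have h2 : ((ilwA k q).norm.natAbs.primeFactors.filter (fun l => M < l)).card ≤ 2 := by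
        apply ilw_large_primes _ _ (by omega)
        · simpa using ilw_norm_ne k hks _ (ilwA_ne k q)
        · simp only [hR, Finset.mem_product, Finset.mem_range] at hq
          obtain ⟨h1, h2⟩ := hq
          zify
          rw [ilwA_norm, abs_lt]
          have e1 : ((q.1:ℤ) + 1)^2 ≤ M^2 := by
            have : (q.1:ℤ) + 1 ≤ M := by exact_mod_cast h1
            gcongr
          have e2 : (q.2:ℤ)^2 ≤ M^2 := by
            have : (q.2:ℤ) ≤ M := by exact_mod_cast h2.le
            gcongr
          have e3 : (k:ℤ) * q.2^2 ≤ k * M^2 := by gcongr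
          have hk1 : (1:ℤ) ≤ k := by exact_mod_cast hk
          have hk2 : (k:ℤ) < M := by exact_mod_cast hkM
          have hM0 : (0:ℤ) < M := by linarith
          have e4 : (k:ℤ) * M^2 < M^3 := by
            have : (k:ℤ) * M^2 < M * M^2 := by gcongr
            linarith [this, show (M:ℤ) * M^2 = M^3 by ring]
          have e5 : (M:ℤ)^2 ≤ k * M^2 := by
            have := mul_le_mul_of_nonneg_right hk1 (sq_nonneg (M:ℤ))
            linarith
          have e6 : (0:ℤ) ≤ k * q.2^2 := by positivity
          constructor <;> nlinarith [sq_nonneg ((q.1:ℤ)+1)]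
      refine (Finset.card_biUnion_le_card_mul _ _ (2 * M) ?_).trans ?_
      · intro l hl
        simp only [Finset.mem_filter] at hl
        have := hb l (Nat.prime_of_mem_primeFactors hl.1)
        rw [Nat.div_eq_of_lt hl.2] at this
        linarith
      · calc _ ≤ 2 * (2 * M) := by gcongr
          _ = 4 * M := by ring
    have c3 := Finset.le_card_sdiff (Bad1 ∪ Bad2) (R ×ˢ R)
    have c4 := Finset.card_union_le Bad1 Bad2
    have c5 : (R ×ˢ R).card = M^4 := by rw [Finset.card_product, hRcard]; ring
    have c6 : 4 * ((M * M) * (4 * M)) ≤ M^4 := by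
      calc 4 * ((M * M) * (4 * M)) = 16 * (M^3) := by ring
        _ ≤ M * M^3 := by gcongr; omega
        _ = M^4 := by ring
    omega
  · intro q hq
    simp only [Finset.mem_sdiff, Finset.mem_union, not_or] at hq
    obtain ⟨h1, h2, h3⟩ := hq
    have hq1 : q.1 ∈ R := (Finset.mem_product.1 h1).1
    have hq2 : q.2 ∈ R := (Finset.mem_product.1 h1).2
    have hq1' := Finset.mem_product.1 hq1
    have hq2' := Finset.mem_product.1 hq2
    simp only [Finset.mem_range] at hq1' hq2'
    refine ⟨hq1'.1, hq1'.2, hq2'.1, hq2'.2, ?_⟩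
    apply ilw_coprime
    rw [Int.isCoprime_iff_gcd_eq_one]
    by_contra hg
    obtain ⟨l, hl, hlg⟩ := Nat.exists_prime_and_dvd hg
    have d1 : (l:ℤ) ∣ (ilwA k q.1).norm :=
      (Int.natCast_dvd_natCast.2 hlg).trans (Int.gcd_dvd_left ..)
    have d2 : (l:ℤ) ∣ (ilwB k L M q.2).norm :=
      (Int.natCast_dvd_natCast.2 hlg).trans (Int.gcd_dvd_right ..)
    have hl64 : 64 < l := by
      by_contra! h
      exact hb0 l hl _ d2 (Int.natCast_dvd_natCast.2 (hL l hl h))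
    have hfb : q.2 ∈ Fb l := Finset.mem_filter.2 ⟨hq2, d2⟩
    by_cases hlM : l ≤ M
    · apply h2
      simp only [hBad1, Finset.mem_biUnion, Finset.mem_filter, Finset.mem_Ioc]
      exact ⟨l, ⟨⟨hl64, hlM⟩, hl⟩, Finset.mem_product.2
        ⟨Finset.mem_filter.2 ⟨hq1, d1⟩, hfb⟩⟩
    · apply h3
      simp only [hBad2, Finset.mem_biUnion]
      refine ⟨q.1, hq1, Finset.mem_product.2 ⟨Finset.mem_singleton_self _, ?_⟩⟩
      simp only [Finset.mem_biUnion, Finset.mem_filter]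
      refine ⟨l, ⟨?_, by omega⟩, hfb⟩
      rw [Nat.mem_primeFactors]
      refine ⟨hl, Int.natCast_dvd.1 d1, ?_⟩
      simpa using ilw_norm_ne k hks _ (ilwA_ne k q.1)

lemma ilw_normB (k : ℕ) (hk : 0 < k) (X : ℤ) (b : ℤ√(k:ℤ))
    (h1 : 8 * k * X ≤ b.re) (h3 : 0 ≤ b.im) (h4 : b.im ≤ X) (hX : 0 < X) :
    63 * (k:ℤ)^2 * X^2 ≤ b.norm := by
  rw [Zsqrtd.norm_def]
  have hk1 : (1:ℤ) ≤ k := by exact_mod_cast hk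
  have e1 : (8 * k * X)^2 ≤ b.re^2 := by gcongr
  have e2 : b.im^2 ≤ X^2 := by gcongr
  have e3 : (k:ℤ) * b.im^2 ≤ k * X^2 := by gcongr
  have e4 : (k:ℤ) * X^2 ≤ k^2 * X^2 := by
    have : (k:ℤ) ≤ k^2 := by nlinarith
    gcongr
  nlinarith

lemma ilw_slope_inj (k : ℕ) (hk : 0 < k) (X : ℤ) (hX : 0 < X) (a b a' b' : ℤ√(k:ℤ))
    (h1 : 8 * k * X ≤ b.re) (h2 : b.re ≤ 9 * k * X) (h3 : 0 ≤ b.im) (h4 : b.im ≤ X)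
    (h1' : 8 * k * X ≤ b'.re) (h2' : b'.re ≤ 9 * k * X) (h3' : 0 ≤ b'.im) (h4' : b'.im ≤ X)
    (hc : IsCoprime a b) (h : a * b' = a' * b) : a' = a ∧ b' = b := by
  obtain ⟨u, v, huv⟩ := hc
  set e := u * a' + v * b' with he
  have hb : b' = e * b := by
    rw [he]; linear_combination (-b') * huv + u * h
  have ha : a' = e * a := by
    rw [he]; linear_combination (-a') * huv - v * h
  have hn := ilw_normB k hk X b h1 h3 h4 hX
  have hk1 : (1:ℤ) ≤ k := by exact_mod_cast hk
  have hbb : b' * star b = e * ((b.norm : ℤ) : ℤ√(k:ℤ)) := by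
    rw [Zsqrtd.norm_eq_mul_conj, hb]; ring
  have hre := congrArg Zsqrtd.re hbb
  have him := congrArg Zsqrtd.im hbb
  simp at hre him
  have hkX : 0 < (k:ℤ) * X := by positivity
  have hkXX : 0 < (k:ℤ) * X * X := by positivity
  have hXX : (k:ℤ) * X * X ≤ k^2 * X^2 := by nlinarith
  have hpos : 0 < b.norm := by nlinarith
  have b0 : 0 ≤ b.re := by linarith
  have b0' : 0 ≤ b'.re := by linarith
  have m1 : b'.re * b.im ≤ 9 * k * X * X := mul_le_mul h2' h4 h3 (by positivity)
  have m2 : b.re * b'.im ≤ 9 * k * X * X := mul_le_mul h2 h4' h3' (by positivity)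
  have m3 : 0 ≤ b'.re * b.im := by positivity
  have m4 : 0 ≤ b.re * b'.im := by positivity
  have e2 : e.im = 0 := by
    have u1 : e.im * b.norm < 1 * b.norm := by nlinarith
    have u2 : (-1) * b.norm < e.im * b.norm := by nlinarith
    have := lt_of_mul_lt_mul_right u1 hpos.le
    have := lt_of_mul_lt_mul_right u2 hpos.le
    omega
  have e1 : e.re = 1 := by
    have m5 : b'.re * b.re ≤ (9 * k * X) * (9 * k * X) := mul_le_mul h2' h2 b0 (by positivity)
    have m6 : (8 * k * X) * (8 * k * X) ≤ b'.re * b.re :=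
      mul_le_mul h1' h1 (by positivity) b0'
    have m7 : b'.im * b.im ≤ X * X := mul_le_mul h4' h4 h3 (by positivity)
    have m8 : (k:ℤ) * (b'.im * b.im) ≤ k * (X * X) := by gcongr
    have m9 : 0 ≤ (k:ℤ) * (b'.im * b.im) := by positivity
    have u1 : e.re * b.norm < 2 * b.norm := by nlinarith
    have u2 : 0 * b.norm < e.re * b.norm := by nlinarith
    have := lt_of_mul_lt_mul_right u1 hpos.le
    have := lt_of_mul_lt_mul_right u2 hpos.le
    omega
  have : e = 1 := by ext <;> simp [e1, e2]
  rw [ha, hb, this]; simp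

lemma ilw_proj_inj (k : ℕ) (hk : 0 < k) (hks : ¬ IsSquare k) (X : ℤ) (hX : 0 < X)
    (a b x x' y y' : ℤ√(k:ℤ))
    (h1 : 8 * k * X ≤ b.re) (h3 : 0 ≤ b.im) (h4 : b.im ≤ X) (hc : IsCoprime a b)
    (hx1 : 0 ≤ x.re) (hx2 : x.re ≤ X) (hx3 : 0 ≤ x.im) (hx4 : x.im ≤ X)
    (hx1' : 0 ≤ x'.re) (hx2' : x'.re ≤ X) (hx3' : 0 ≤ x'.im) (hx4' : x'.im ≤ X)
    (h : b * y - a * x = b * y' - a * x') : x = x' ∧ y = y' := by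
  have hn := ilw_normB k hk X b h1 h3 h4 hX
  have hk1 : (1:ℤ) ≤ k := by exact_mod_cast hk
  have hkXX : 0 < (k:ℤ) * X^2 := by positivity
  have hXX : (k:ℤ) * X^2 ≤ k^2 * X^2 := by
    have : (k:ℤ) ≤ k^2 := by nlinarith
    gcongr
  have hpos : 0 < b.norm := by nlinarith
  have hd : b ∣ a * (x - x') := ⟨y - y', by linear_combination -h⟩
  obtain ⟨t, ht⟩ := hc.symm.dvd_of_dvd_mul_left hd
  have hN : b.norm ∣ (x - x').norm := ⟨t.norm, by rw [ht, Zsqrtd.norm_mul]⟩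
  have hz : (x - x').norm = 0 := by
    apply Int.eq_zero_of_abs_lt_dvd hN
    rw [Zsqrtd.norm_def]
    simp only [Zsqrtd.re_sub, Zsqrtd.im_sub]
    have s1 : (x.re - x'.re)^2 ≤ X^2 := sq_le_sq' (by linarith) (by linarith)
    have s2 : (x.im - x'.im)^2 ≤ X^2 := sq_le_sq' (by linarith) (by linarith)
    have s3 : (k:ℤ) * (x.im - x'.im)^2 ≤ k * X^2 := by gcongr
    have s4 : 0 ≤ (k:ℤ) * (x.im - x'.im)^2 := by positivity
    have s5 : X^2 ≤ k * X^2 := by nlinarith [sq_nonneg X]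
    rw [abs_lt]
    constructor <;> nlinarith [sq_nonneg (x.re - x'.re)]
  have hxx : x = x' := by
    by_contra hne
    exact ilw_norm_ne k hks _ (sub_ne_zero.2 hne) hz
  refine ⟨hxx, ?_⟩
  subst hxx
  have hby : b * (y - y') = 0 := by linear_combination h
  by_contra hne
  have h5 := congrArg Zsqrtd.norm hby
  rw [Zsqrtd.norm_mul, Zsqrtd.norm_zero] at h5
  rcases mul_eq_zero.1 h5 with h6 | h6
  · exact hpos.ne' h6
  · exact ilw_norm_ne k hks _ (sub_ne_zero.2 hne) h6

noncomputable def ilwPhi (k : ℕ) : ℤ√(k:ℤ) →+* ℝ := Zsqrtd.toReal (Int.natCast_nonneg k)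

lemma ilwPhi_apply (k : ℕ) (z : ℤ√(k:ℤ)) : ilwPhi k z = z.re + z.im * Real.sqrt k := by
  simp [ilwPhi, Zsqrtd.toReal_apply]

lemma ilwPhi_inj (k : ℕ) (hks : ¬ IsSquare k) : Function.Injective (ilwPhi k) :=
  Zsqrtd.toReal_injective _ (ilw_nsq k hks)

lemma ilw_abs_iff (N : ℕ) (x : ℤ) : |(x:ℝ)| ≤ Real.sqrt N ↔ |x| ≤ (Nat.sqrt N : ℤ) := by
  rw [Real.le_sqrt (abs_nonneg _) (by positivity), ← Int.natCast_natAbs, Int.ofNat_le,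
    Nat.le_sqrt', ← Int.cast_abs, ← Int.natCast_natAbs]
  norm_cast

lemma ilw_mem_aSet (k N : ℕ) (x : ℝ) : x ∈ aSet k N ↔
    ∃ z : ℤ√(k:ℤ), |z.re| ≤ (Nat.sqrt N : ℤ) ∧ |z.im| ≤ (Nat.sqrt N : ℤ) ∧ x = ilwPhi k z := by
  constructor
  · rintro ⟨x1, x2, h1, h2, rfl⟩
    exact ⟨⟨x1, x2⟩, (ilw_abs_iff N x1).1 h1, (ilw_abs_iff N x2).1 h2, by rw [ilwPhi_apply]⟩
  · rintro ⟨z, h1, h2, rfl⟩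
    exact ⟨z.re, z.im, (ilw_abs_iff N _).2 h1, (ilw_abs_iff N _).2 h2, ilwPhi_apply k z⟩

lemma ilw_coef (c x B R : ℤ) (h0 : 0 ≤ c) (hc : c ≤ B) (hx : |x| ≤ R) : |c * x| ≤ B * R := by
  rw [abs_mul, abs_of_nonneg h0]
  exact mul_le_mul hc hx (abs_nonneg _) (h0.trans hc)

lemma ilw_size (k : ℕ) (hk : 0 < k) (hks : ¬ IsSquare k) (X M N : ℕ) (hM : 0 < M) (hMX : M ≤ X)
    (hMN : M ≤ Nat.sqrt N) (a b : ℤ√(k:ℤ))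
    (h1 : 8 * k * (X:ℤ) ≤ b.re) (h2 : b.re ≤ 9 * k * (X:ℤ)) (h3 : 0 ≤ b.im) (h4 : b.im ≤ X)
    (g1 : 0 ≤ a.re) (g2 : a.re ≤ X) (g3 : 0 ≤ a.im) (g4 : a.im ≤ X) (hc : IsCoprime a b) :
    M^2 * N ≤ {v : ℝ | ∃ x ∈ aSet k N, ∃ y ∈ aSet k N,
        v = y - (ilwPhi k a / ilwPhi k b) * x}.ncard ∧
    {v : ℝ | ∃ x ∈ aSet k N, ∃ y ∈ aSet k N,
        v = y - (ilwPhi k a / ilwPhi k b) * x}.ncard ≤ (54 * k * (1 + k) * X)^2 * N := by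
  classical
  set R := Nat.sqrt N with hR
  have hR1 : 1 ≤ R := by omega
  have hRN : R^2 ≤ N := Nat.sqrt_le' N
  have hNR : N ≤ (R+1)^2 := (Nat.lt_succ_sqrt' N).le
  have hX : 0 < X := by omega
  have hXi : (0:ℤ) < X := by exact_mod_cast hX
  have hb0 : b ≠ 0 := by
    rintro rfl
    simp only [Zsqrtd.re_zero] at h1
    have : (0:ℤ) < 8 * k * X := by positivity
    omega
  have hφb : ilwPhi k b ≠ 0 := (map_ne_zero_iff _ (ilwPhi_inj k hks)).2 hb0
  set S := {v : ℝ | ∃ x ∈ aSet k N, ∃ y ∈ aSet k N, v = y - (ilwPhi k a / ilwPhi k b) * x} with hS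
  have key : ∀ x y : ℤ√(k:ℤ), ilwPhi k y - (ilwPhi k a / ilwPhi k b) * ilwPhi k x
      = ilwPhi k (b * y - a * x) / ilwPhi k b := by
    intro x y
    rw [map_sub, map_mul, map_mul]
    field_simp
  set W : ℕ := 18 * k * (1 + k) * X * R with hW
  have hW1 : 1 ≤ W := Nat.one_le_iff_ne_zero.2 (by positivity)
  set U : Finset ℝ := (Finset.Icc (-(W:ℤ)) W ×ˢ Finset.Icc (-(W:ℤ)) W).image
    (fun q => ilwPhi k ⟨q.1, q.2⟩ / ilwPhi k b) with hU
  have hSU : S ⊆ (U : Set ℝ) := by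
    rintro v ⟨x, hx, y, hy, rfl⟩
    obtain ⟨x, hx1, hx2, rfl⟩ := (ilw_mem_aSet k N x).1 hx
    obtain ⟨y, hy1, hy2, rfl⟩ := (ilw_mem_aSet k N y).1 hy
    rw [key]
    simp only [hU, Finset.coe_image, Set.mem_image, Finset.mem_coe, Finset.mem_product,
      Finset.mem_Icc]
    refine ⟨((b * y - a * x).re, (b * y - a * x).im), ?_, rfl⟩
    have hk1 : (1:ℤ) ≤ k := by exact_mod_cast hk
    have hXR : (0:ℤ) ≤ X * R := by positivity
    have q1 : (X:ℤ) * R ≤ k * (X * R) := by nlinarith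
    have q2 : (0:ℤ) ≤ k * (k * (X * R)) := by positivity
    have q3 : (k:ℤ) * (X * R) ≤ k * (k * (X * R)) := by gcongr
    have hWz : (W:ℤ) = 18 * (k * (X * R)) + 18 * (k * (k * (X * R))) := by
      rw [hW]; push_cast; ring
    have t1 := abs_le.1 (ilw_coef _ _ _ _ (by linarith [show (0:ℤ) ≤ 8 * k * X by positivity]) h2 hy1)
    have t2 := abs_le.1 (ilw_coef _ _ _ _ (by linarith [show (0:ℤ) ≤ 8 * k * X by positivity]) h2 hy2)
    have t3 := abs_le.1 (ilw_coef _ _ _ _ h3 h4 hy1)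
    have t4 := abs_le.1 (ilw_coef _ _ _ _ h3 h4 hy2)
    have t5 := abs_le.1 (ilw_coef _ _ _ _ g1 g2 hx1)
    have t6 := abs_le.1 (ilw_coef _ _ _ _ g1 g2 hx2)
    have t7 := abs_le.1 (ilw_coef _ _ _ _ g3 g4 hx1)
    have t8 := abs_le.1 (ilw_coef _ _ _ _ g3 g4 hx2)
    have t9 := abs_le.1 (ilw_coef k _ k _ (by positivity) le_rfl (abs_le.2 t4))
    have t10 := abs_le.1 (ilw_coef k _ k _ (by positivity) le_rfl (abs_le.2 t8))
    simp only [Zsqrtd.re_sub, Zsqrtd.im_sub, Zsqrtd.re_mul, Zsqrtd.im_mul]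
    rw [hWz]
    refine ⟨⟨?_, ?_⟩, ⟨?_, ?_⟩⟩ <;> linarith
  have hfin : S.Finite := (Finset.finite_toSet U).subset hSU
  constructor
  · set T := (Finset.range M ×ˢ Finset.range M) ×ˢ
      (Finset.Icc (-(R:ℤ)) R ×ˢ Finset.Icc (-(R:ℤ)) R) with hT
    set f : (ℕ × ℕ) × (ℤ × ℤ) → ℝ := fun q =>
      ilwPhi k (b * ⟨q.2.1, q.2.2⟩ - a * ⟨q.1.1, q.1.2⟩) / ilwPhi k b with hf
    have hinj : Set.InjOn f T := by
      rintro ⟨⟨x1, x2⟩, ⟨y1, y2⟩⟩ hq ⟨⟨x1', x2'⟩, ⟨y1', y2'⟩⟩ hq' h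
      simp only [hT, Finset.coe_product, Set.mem_prod, Finset.mem_coe, Finset.mem_range] at hq hq'
      obtain ⟨⟨hx1, hx2⟩, _⟩ := hq
      obtain ⟨⟨hx1', hx2'⟩, _⟩ := hq'
      simp only [hf] at h
      have h' := ilwPhi_inj k hks ((div_left_inj' hφb).1 h)
      obtain ⟨e1, e2⟩ := ilw_proj_inj k hk hks X hXi a b _ _ _ _ h1 h3 h4 hc
        (by simp) (by simp; omega) (by simp) (by simp; omega)
        (by simp) (by simp; omega) (by simp) (by simp; omega) h'
      simp only [Zsqrtd.mk.injEq, Nat.cast_inj] at e1 e2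
      simp [e1, e2]
    have hTS : ((T.image f : Finset ℝ) : Set ℝ) ⊆ S := by
      intro v hv
      simp only [Finset.coe_image, Set.mem_image, Finset.mem_coe] at hv
      obtain ⟨⟨⟨x1, x2⟩, ⟨y1, y2⟩⟩, hq, rfl⟩ := hv
      simp only [hT, Finset.mem_product, Finset.mem_range, Finset.mem_Icc] at hq
      obtain ⟨⟨hx1, hx2⟩, hy1, hy2⟩ := hq
      refine ⟨ilwPhi k ⟨x1, x2⟩, (ilw_mem_aSet k N _).2 ⟨_, ?_, ?_, rfl⟩,
        ilwPhi k ⟨y1, y2⟩, (ilw_mem_aSet k N _).2 ⟨_, ?_, ?_, rfl⟩, (key _ _).symm⟩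
      · simp only [Nat.abs_cast]; omega
      · simp only [Nat.abs_cast]; omega
      · exact abs_le.2 hy1
      · exact abs_le.2 hy2
    have h5 := Set.ncard_le_ncard hTS hfin
    rw [Set.ncard_coe_finset, Finset.card_image_of_injOn hinj] at h5
    refine le_trans ?_ h5
    have hcI : (Finset.Icc (-(R:ℤ)) R).card = 2 * R + 1 := by
      rw [Int.card_Icc]; omega
    rw [hT, Finset.card_product, Finset.card_product, Finset.card_product, hcI, Finset.card_range]
    calc M^2 * N ≤ M^2 * (R+1)^2 := by gcongr
      _ ≤ M^2 * (2*R+1)^2 := by gcongr; omega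
      _ = _ := by ring
  · have h5 := Set.ncard_le_ncard hSU (Finset.finite_toSet U)
    rw [Set.ncard_coe_finset] at h5
    have hcI : (Finset.Icc (-(W:ℤ)) W).card = 2 * W + 1 := by
      rw [Int.card_Icc]; omega
    calc _ ≤ U.card := h5
      _ ≤ _ := Finset.card_image_le
      _ = (2 * W + 1)^2 := by rw [Finset.card_product, hcI]; ring
      _ ≤ (3 * W)^2 := by gcongr; omega
      _ = (54 * k * (1 + k) * X)^2 * R^2 := by rw [hW]; ring
      _ ≤ _ := by gcongr

lemma ilw_main (k : ℕ) (hk : 0 < k) (hks : ¬ IsSquare k) (L : ℕ) (hL0 : 0 < L)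
    (hL : ∀ l : ℕ, l.Prime → l ≤ 64 → l ∣ L) :
    ∃ c₁ c₂ C₂ : ℝ, 0 < c₁ ∧ 0 < c₂ ∧ 0 < C₂ ∧
      ∀ p : ℕ, 1 ≤ p → ∃ N₀ : ℕ, ∀ N : ℕ, N₀ ≤ N →
        ∃ D : Finset ℝ, c₁ * (p : ℝ) ≤ (D.card : ℝ) ∧
          ∀ s ∈ D,
            c₂ * Real.sqrt (p : ℝ) * (N : ℝ) ≤
              ({v : ℝ | ∃ x ∈ aSet k N, ∃ y ∈ aSet k N, v = y - s * x}.ncard : ℝ) ∧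
            ({v : ℝ | ∃ x ∈ aSet k N, ∃ y ∈ aSet k N, v = y - s * x}.ncard : ℝ) ≤
              C₂ * Real.sqrt (p : ℝ) * (N : ℝ) := by
  classical
  refine ⟨1/2, 1, 4 * (54 * k * (1 + k) * (L * (k + 64)))^2, by norm_num, by norm_num,
    by positivity, ?_⟩
  intro p hp
  set r := Nat.sqrt p with hr
  set m := Nat.sqrt r + 1 with hm
  have hr1 : 1 ≤ r := Nat.le_sqrt.2 (by omega)
  have hrr1 : 1 ≤ Nat.sqrt r := Nat.le_sqrt.2 (by omega)
  have hm1 : r + 1 ≤ m^2 := Nat.lt_succ_sqrt' r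
  have hm2 : m^2 ≤ 4 * r := by
    calc m^2 ≤ (2 * Nat.sqrt r)^2 := by gcongr; omega
      _ = 4 * (Nat.sqrt r)^2 := by ring
      _ ≤ 4 * r := by gcongr; exact Nat.sqrt_le' r
  have hpr : p ≤ (r+1)^2 := (Nat.lt_succ_sqrt' p).le
  have hrp : (r:ℝ) ≤ Real.sqrt p := Real.nat_sqrt_le_real_sqrt
  have hpr' : Real.sqrt p ≤ (r:ℝ) + 1 := by
    rw [Real.sqrt_le_left (by positivity)]
    exact_mod_cast hpr
  set M := (k + 64) * m with hM
  have hMm : m ≤ M := by rw [hM]; nlinarith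
  have hMk : k + 64 ≤ M := by rw [hM]; nlinarith
  obtain ⟨G, hG1, hG2⟩ := ilw_good_count k L M hk hks hL (by omega) (by omega)
  set X := L * M with hX
  have hMX : M ≤ X := by rw [hX]; nlinarith
  have hX0 : (0:ℤ) < X := by exact_mod_cast (by omega : 0 < X)
  have hbnd : ∀ q : ℕ × ℕ, q.1 < M → q.2 < M → 8 * k * (X:ℤ) ≤ (ilwB k L M q).re ∧
      (ilwB k L M q).re ≤ 9 * k * (X:ℤ) ∧ 0 ≤ (ilwB k L M q).im ∧ (ilwB k L M q).im ≤ X := by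
    intro q h1 h2
    simp only [ilwB, hX]
    have w1 : L * q.1 + 1 ≤ L * M := by
      calc L * q.1 + 1 ≤ L * q.1 + L := by omega
        _ = L * (q.1 + 1) := by ring
        _ ≤ L * M := by gcongr; omega
    have w2 : L * q.2 ≤ L * M := by gcongr
    have w3 : L * M ≤ k * (L * M) := Nat.le_mul_of_pos_left _ hk
    zify at w1 w2 w3
    push_cast
    refine ⟨?_, ?_, by positivity, w2⟩
    · nlinarith [show (0:ℤ) ≤ L * q.1 by positivity]
    · nlinarith
  have hinj : Set.InjOn (fun q : (ℕ × ℕ) × (ℕ × ℕ) =>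
      ilwPhi k (ilwA k q.1) / ilwPhi k (ilwB k L M q.2)) G := by
    intro q hq q' hq' h
    obtain ⟨u1, u2, u3, u4, hc⟩ := hG2 q hq
    obtain ⟨u1', u2', u3', u4', hc'⟩ := hG2 q' hq'
    obtain ⟨v1, v2, v3, v4⟩ := hbnd q.2 u3 u4
    obtain ⟨v1', v2', v3', v4'⟩ := hbnd q'.2 u3' u4'
    have hne : ∀ b : ℤ√(k:ℤ), 8 * k * (X:ℤ) ≤ b.re → ilwPhi k b ≠ 0 := by
      intro b hb
      apply (map_ne_zero_iff _ (ilwPhi_inj k hks)).2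
      rintro rfl
      simp only [Zsqrtd.re_zero] at hb
      have : (0:ℤ) < 8 * k * X := by positivity
      omega
    simp only at h
    rw [div_eq_div_iff (hne _ v1) (hne _ v1'), ← map_mul, ← map_mul] at h
    obtain ⟨e1, e2⟩ := ilw_slope_inj k hk X hX0 _ _ _ _ v1 v2 v3 v4 v1' v2' v3' v4' hc
      (ilwPhi_inj k hks h)
    simp only [ilwA, ilwB, Zsqrtd.mk.injEq] at e1 e2
    have hLz : (L:ℤ) ≠ 0 := by exact_mod_cast hL0.ne'
    have f1 : (q'.2.1 : ℤ) = q.2.1 := mul_left_cancel₀ hLz (add_right_cancel e2.1)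
    have f2 : (q'.2.2 : ℤ) = q.2.2 := mul_left_cancel₀ hLz e2.2
    have f3 := e1.1
    have f4 := e1.2
    ext <;> omega
  refine ⟨M^2, fun N hN => ⟨G.image (fun q : (ℕ × ℕ) × (ℕ × ℕ) =>
      ilwPhi k (ilwA k q.1) / ilwPhi k (ilwB k L M q.2)), ?_, ?_⟩⟩
  · rw [Finset.card_image_of_injOn hinj]
    have : p ≤ 2 * G.card := by
      calc p ≤ (r+1)^2 := hpr
        _ ≤ (m^2)^2 := by gcongr
        _ = m^4 := by ring
        _ ≤ M^4 := by gcongr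
        _ ≤ _ := hG1
    have : (p:ℝ) ≤ 2 * G.card := by exact_mod_cast this
    linarith
  · intro s hs
    obtain ⟨q, hq, rfl⟩ := Finset.mem_image.1 hs
    obtain ⟨u1, u2, u3, u4, hc⟩ := hG2 q hq
    obtain ⟨v1, v2, v3, v4⟩ := hbnd q.2 u3 u4
    obtain ⟨z1, z2⟩ := ilw_size k hk hks X M N (by omega) hMX (Nat.le_sqrt'.2 hN)
      (ilwA k q.1) (ilwB k L M q.2) v1 v2 v3 v4 (by simp only [ilwA]; omega)
      (by simp only [ilwA]; omega) (by simp only [ilwA]; omega) (by simp only [ilwA]; omega) hc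
    constructor
    · refine le_trans ?_ (Nat.cast_le.2 z1)
      push_cast
      rw [one_mul]
      gcongr
      calc Real.sqrt p ≤ (r:ℝ) + 1 := hpr'
        _ ≤ (m:ℝ)^2 := by exact_mod_cast hm1
        _ ≤ (M:ℝ)^2 := by gcongr
    · refine (Nat.cast_le.2 z2).trans ?_
      push_cast
      gcongr
      have hm3 : (m:ℝ)^2 ≤ 4 * Real.sqrt p := by
        have : (m:ℝ)^2 ≤ 4 * r := by exact_mod_cast hm2
        linarith
      rw [hX, hM]
      push_cast
      calc (54 * (k:ℝ) * (1 + k) * (L * ((k + 64) * m)))^2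
          = (54 * k * (1 + k) * (L * (k + 64)))^2 * (m:ℝ)^2 := by ring
        _ ≤ (54 * k * (1 + k) * (L * (k + 64)))^2 * (4 * Real.sqrt p) := by gcongr
        _ = _ := by ring

/-- Inverse Loomis–Whitney example: for `P = A_N × A_N` there are `≥ c₁·p` slopes along
which the projection of `P` has size `Θ(√p·N)`. -/
theorem inverse_loomis_whitney_example (k : ℕ) (hk : 0 < k) (hks : ¬ IsSquare k) :
    ∃ c₁ c₂ C₂ : ℝ, 0 < c₁ ∧ 0 < c₂ ∧ 0 < C₂ ∧
      ∀ p : ℕ, 1 ≤ p → ∃ N₀ : ℕ, ∀ N : ℕ, N₀ ≤ N →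
        ∃ D : Finset ℝ, c₁ * (p : ℝ) ≤ (D.card : ℝ) ∧
          ∀ s ∈ D,
            c₂ * Real.sqrt (p : ℝ) * (N : ℝ) ≤
              ({v : ℝ | ∃ x ∈ aSet k N, ∃ y ∈ aSet k N, v = y - s * x}.ncard : ℝ) ∧
            ({v : ℝ | ∃ x ∈ aSet k N, ∃ y ∈ aSet k N, v = y - s * x}.ncard : ℝ) ≤
              C₂ * Real.sqrt (p : ℝ) * (N : ℝ) := by
  exact ilw_main k hk hks (Nat.factorial 64) (Nat.factorial_pos 64)
    (fun l hl h => Nat.dvd_factorial hl.pos h)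
end

section
/- (Sharpness of the energy bound) For every positive integer k that is not a perfect square there exists c* ∈ (0,1) such that for every constant c ∈ (c*,1) there exist a constant c₅ > 0 and N₀ such that for all N ≥ N₀ and all real M with 1 ≤ M ≤ N, taking X = S (the slope set with parameters M and c), one has |X| ≤ |A_N|² and Σ_{x ∈ X} E⁺(A_N, x·A_N) ≥ c₅·|A_N|³·|X|^{1/2}. -/
/-- The slope set `S` with parameters `M` and `c`. -/
def slopeSet (k : ℕ) (M c : ℝ) : Set ℝ :=
  {s : ℝ | ∃ p₁ p₂ q₁ q₂ : ℤ,
    (c * Real.sqrt M ≤ |(p₁ : ℝ)| ∧ |(p₁ : ℝ)| ≤ Real.sqrt M) ∧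
    (c * Real.sqrt M ≤ |(p₂ : ℝ)| ∧ |(p₂ : ℝ)| ≤ Real.sqrt M) ∧
    (c * Real.sqrt M ≤ |(q₁ : ℝ)| ∧ |(q₁ : ℝ)| ≤ Real.sqrt M) ∧
    (c * Real.sqrt M ≤ |(q₂ : ℝ)| ∧ |(q₂ : ℝ)| ≤ Real.sqrt M) ∧
    (¬ ∃ d : ℕ, d.Prime ∧ 5 < d ∧
      (d : ℤ) ∣ (p₁ ^ 2 - (k : ℤ) * p₂ ^ 2) ∧ (d : ℤ) ∣ (q₁ ^ 2 - (k : ℤ) * q₂ ^ 2)) ∧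
    (¬ ∃ d : ℕ, d.Prime ∧ 5 < d ∧ (d : ℤ) ∣ p₁ ∧ (d : ℤ) ∣ p₂) ∧
    s = ((p₁ : ℝ) + (p₂ : ℝ) * Real.sqrt k) / ((q₁ : ℝ) + (q₂ : ℝ) * Real.sqrt k)}

/-- The additive energy `E⁺(A,B)`: the number of quadruples `(a, a', b, b') ∈ A×A×B×B`
with `a + b = a' + b'`. -/
noncomputable def addEnergy (A B : Set ℝ) : ℕ :=
  {x : ℝ × ℝ × ℝ × ℝ | x.1 ∈ A ∧ x.2.1 ∈ A ∧ x.2.2.1 ∈ B ∧ x.2.2.2 ∈ B ∧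
    x.1 + x.2.2.1 = x.2.1 + x.2.2.2}.ncard


/-- Points of an interval in one residue class. -/
lemma cls_card (d : ℕ) (hd : 0 < d) (A : ℤ) (L : ℕ) (v : ℤ) :
    (((Finset.Ico A (A + L)).filter (fun a => (d : ℤ) ∣ a - v)).card : ℝ) ≤ L / d + 1 := by
  have hdz : (0 : ℤ) < d := by exact_mod_cast hd
  have h := Int.Ico_filter_modEq_card (A) (A + L) hdz v
  have e : ((Finset.Ico A (A + L)).filter (fun a => (d : ℤ) ∣ a - v)) =
      ((Finset.Ico A (A + L)).filter (fun a => a ≡ v [ZMOD d])) := by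
    apply Finset.filter_congr
    intro a _
    rw [Int.modEq_comm, Int.modEq_iff_dvd]
  rw [e]
  have h' : ((((Finset.Ico A (A + L)).filter (fun a => a ≡ v [ZMOD d])).card : ℤ) : ℝ) =
    ((max (⌈((A + L : ℤ) - v : ℚ) / (d : ℤ)⌉ - ⌈((A : ℤ) - v : ℚ) / (d : ℤ)⌉) 0 : ℤ) : ℝ) := by
    exact congrArg (Int.cast : ℤ → ℝ) h
  have h1 : ((⌈((A + L : ℤ) - v : ℚ) / (d : ℤ)⌉ : ℤ) : ℚ) < ((A + L : ℤ) - v : ℚ) / (d : ℤ) + 1 :=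
    Int.ceil_lt_add_one _
  have h2 := Int.le_ceil (((A : ℤ) - v : ℚ) / (d : ℤ))
  have h3 : ((⌈((A + L : ℤ) - v : ℚ) / (d : ℤ)⌉ - ⌈((A : ℤ) - v : ℚ) / (d : ℤ)⌉ : ℤ) : ℚ) ≤ L / d + 1 := by
    push_cast at *
    have : ((A : ℚ) + L - v) / d = (A - v) / d + L / d := by ring
    linarith
  rw [Int.cast_natCast] at h'
  rw [h']
  have h4 : ((⌈((A + L : ℤ) - v : ℚ) / (d : ℤ)⌉ - ⌈((A : ℤ) - v : ℚ) / (d : ℤ)⌉ : ℤ) : ℝ) ≤ L / d + 1 := by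
    generalize (⌈((A + L : ℤ) - v : ℚ) / (d : ℤ)⌉ - ⌈((A : ℤ) - v : ℚ) / (d : ℤ)⌉ : ℤ) = z at h3
    have := (Rat.cast_le (K := ℝ)).2 h3
    push_cast at this
    exact this
  rw [Int.cast_max]
  refine max_le h4 ?_
  simp only [Int.cast_zero]; positivity

lemma root_card (d : ℕ) (hd : d.Prime) (P : ℤ) (hdP : ¬ (d : ℤ) ∣ P) (A : ℤ) (L : ℕ) (w : ℤ) :
    (((Finset.Ico A (A + L)).filter (fun a => (d : ℤ) ∣ (1 + P * a) ^ 2 - w)).card : ℝ)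
      ≤ 2 * (L / d + 1) := by
  have hp : Prime (d : ℤ) := Nat.prime_iff_prime_int.1 hd
  have key : ∃ a0 a1 : ℤ, ∀ a, (d : ℤ) ∣ (1 + P * a) ^ 2 - w →
      (d : ℤ) ∣ a - a0 ∨ (d : ℤ) ∣ a - a1 := by
    by_cases h0 : ∃ a0, (d : ℤ) ∣ (1 + P * a0) ^ 2 - w
    · obtain ⟨a0, h0⟩ := h0
      have st : ∀ a, (d : ℤ) ∣ (1 + P * a) ^ 2 - w →
          (d : ℤ) ∣ a - a0 ∨ (d : ℤ) ∣ 2 + P * (a + a0) := by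
        intro a ha
        have h := dvd_sub ha h0
        have e : (1 + P * a) ^ 2 - w - ((1 + P * a0) ^ 2 - w) =
          P * ((a - a0) * (2 + P * (a + a0))) := by ring
        rw [e] at h
        exact hp.dvd_or_dvd ((hp.dvd_or_dvd h).resolve_left hdP)
      by_cases h1 : ∃ a1, (d : ℤ) ∣ 2 + P * (a1 + a0)
      · obtain ⟨a1, h1⟩ := h1
        refine ⟨a0, a1, fun a ha => ?_⟩
        rcases st a ha with h | h
        · exact Or.inl h
        · right
          have h' := dvd_sub h h1
          have e : 2 + P * (a + a0) - (2 + P * (a1 + a0)) = P * (a - a1) := by ring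
          rw [e] at h'
          exact (hp.dvd_or_dvd h').resolve_left hdP
      · refine ⟨a0, a0, fun a ha => ?_⟩
        rcases st a ha with h | h
        · exact Or.inl h
        · exact absurd ⟨a, h⟩ h1
    · exact ⟨0, 0, fun a ha => absurd ⟨a, ha⟩ h0⟩
  obtain ⟨a0, a1, h⟩ := key
  have hsub : (Finset.Ico A (A + L)).filter (fun a => (d : ℤ) ∣ (1 + P * a) ^ 2 - w) ⊆
      ((Finset.Ico A (A + L)).filter (fun a => (d : ℤ) ∣ a - a0)) ∪
      ((Finset.Ico A (A + L)).filter (fun a => (d : ℤ) ∣ a - a1)) := by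
    intro a ha
    simp only [Finset.mem_filter, Finset.mem_union] at ha ⊢
    rcases h a ha.2 with h | h
    · exact Or.inl ⟨ha.1, h⟩
    · exact Or.inr ⟨ha.1, h⟩
  have h1 := (Finset.card_le_card hsub).trans (Finset.card_union_le _ _)
  have h2 := cls_card d hd.pos A L a0
  have h3 := cls_card d hd.pos A L a1
  have h4 : (((Finset.Ico A (A + L)).filter (fun a => (d : ℤ) ∣ (1 + P * a) ^ 2 - w)).card : ℝ) ≤
    ((Finset.Ico A (A + L)).filter (fun a => (d : ℤ) ∣ a - a0)).card +
      ((Finset.Ico A (A + L)).filter (fun a => (d : ℤ) ∣ a - a1)).card := by exact_mod_cast h1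
  linarith

/-- The norm form on the chosen residue class. -/
def nrm (k P : ℕ) (u : ℤ × ℤ) : ℤ := (1 + P * u.1) ^ 2 - k * (P * u.2) ^ 2

/-- The box of parameters. -/
noncomputable def bx (A : ℤ) (L : ℕ) : Finset (ℤ × ℤ) := Finset.Ico A (A + L) ×ˢ Finset.Ico A (A + L)

lemma bx_card (A : ℤ) (L : ℕ) : (bx A L).card = L ^ 2 := by
  simp [bx, sq]

lemma F_card (k P d : ℕ) (hd : d.Prime) (hdP : ¬ (d : ℤ) ∣ (P : ℤ)) (A : ℤ) (L : ℕ) :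
    (((bx A L).filter (fun u => (d : ℤ) ∣ nrm k P u)).card : ℝ) ≤ L * (2 * (L / d + 1)) := by
  have e : ((bx A L).filter (fun u => (d : ℤ) ∣ nrm k P u)).card =
      ∑ b ∈ Finset.Ico A (A + L),
        ((Finset.Ico A (A + L)).filter (fun a => (d : ℤ) ∣ (1 + P * a) ^ 2 - k * (P * b) ^ 2)).card := by
    rw [Finset.card_filter, bx, Finset.sum_product_right]
    simp only [Finset.card_filter, nrm]
    rfl
  rw [e]
  push_cast
  calc _ ≤ ∑ b ∈ Finset.Ico A (A + L), (2 * ((L : ℝ) / d + 1)) :=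
        Finset.sum_le_sum fun b _ => root_card d hd P hdP A L _
    _ = _ := by simp

lemma G_card (P d : ℕ) (hd : d.Prime) (hdP : ¬ (d : ℤ) ∣ (P : ℤ)) (A : ℤ) (L : ℕ) :
    (((bx A L).filter (fun u => (d : ℤ) ∣ 1 + P * u.1 ∧ (d : ℤ) ∣ P * u.2)).card : ℝ) ≤
      (L / d + 1) ^ 2 := by
  have hp : Prime (d : ℤ) := Nat.prime_iff_prime_int.1 hd
  by_cases h : ∃ a0, (d : ℤ) ∣ 1 + P * a0
  · obtain ⟨a0, h0⟩ := h
    have hsub : (bx A L).filter (fun u => (d : ℤ) ∣ 1 + P * u.1 ∧ (d : ℤ) ∣ P * u.2) ⊆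
        ((Finset.Ico A (A + L)).filter (fun a => (d : ℤ) ∣ a - a0)) ×ˢ
        ((Finset.Ico A (A + L)).filter (fun a => (d : ℤ) ∣ a - 0)) := by
      intro u hu
      simp only [bx, Finset.mem_filter, Finset.mem_product] at hu ⊢
      refine ⟨⟨hu.1.1, ?_⟩, hu.1.2, ?_⟩
      · have h' := dvd_sub hu.2.1 h0
        have e : 1 + (P : ℤ) * u.1 - (1 + P * a0) = P * (u.1 - a0) := by ring
        rw [e] at h'
        exact (hp.dvd_or_dvd h').resolve_left hdP
      · rw [sub_zero]
        exact (hp.dvd_or_dvd hu.2.2).resolve_left hdP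
    have h1 := Finset.card_le_card hsub
    rw [Finset.card_product] at h1
    have h2 := cls_card d hd.pos A L a0
    have h3 := cls_card d hd.pos A L 0
    calc _ ≤ (((Finset.Ico A (A + L)).filter (fun a => (d : ℤ) ∣ a - a0)).card : ℝ) *
        ((Finset.Ico A (A + L)).filter (fun a => (d : ℤ) ∣ a - 0)).card := by exact_mod_cast h1
      _ ≤ (L / d + 1) * (L / d + 1) := by gcongr
      _ = _ := by ring
  · have : (bx A L).filter (fun u => (d : ℤ) ∣ 1 + P * u.1 ∧ (d : ℤ) ∣ P * u.2) = ∅ := by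
      apply Finset.filter_false_of_mem
      intro u _ hu
      exact h ⟨_, hu.1⟩
    rw [this]
    simp only [Finset.card_empty, Nat.cast_zero]
    positivity

lemma nrm_not_dvd (k P d : ℕ) (hd : d.Prime) (u : ℤ × ℤ) (h : (d : ℤ) ∣ nrm k P u) :
    ¬ (d : ℤ) ∣ (P : ℤ) := by
  intro hP
  have hp : Prime (d : ℤ) := Nat.prime_iff_prime_int.1 hd
  have e : (1 : ℤ) = nrm k P u - P * (2 * u.1 + P * u.1 ^ 2 - k * P * u.2 ^ 2) := by
    unfold nrm; ring
  have : (d : ℤ) ∣ 1 := by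
    rw [e]; exact dvd_sub h (hP.mul_right _)
  exact hp.not_dvd_one this

lemma nrm_ne (k P : ℕ) (h2 : 2 ∣ P) (u : ℤ × ℤ) : nrm k P u ≠ 0 := by
  intro h
  refine nrm_not_dvd k P 2 Nat.prime_two u ?_ (by exact_mod_cast h2)
  rw [h]; exact dvd_zero _

lemma large_primes (n L K : ℕ) (hn : n ≠ 0) (hnK : n ≤ K) (hKL : K < L ^ 3) (hL : 1 ≤ L)
    (S : Finset ℕ) (hS : ∀ d ∈ S, d.Prime ∧ L < d) :
    (S.filter (fun (d : ℕ) => d ∣ n)).card ≤ 2 := by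
  by_contra hc
  push Not at hc
  have h1 : L ^ (S.filter (fun (d : ℕ) => d ∣ n)).card ≤ ∏ d ∈ S.filter (fun (d : ℕ) => d ∣ n), d :=
    Finset.pow_card_le_prod _ _ _ fun d hd => (hS d (Finset.mem_filter.1 hd).1).2.le
  have h2 : ∏ d ∈ S.filter (fun (d : ℕ) => d ∣ n), d ∣ n := by
    refine (Finset.prod_dvd_prod_of_subset _ n.primeFactors _ ?_).trans (Nat.prod_primeFactors_dvd n)
    intro d hd
    rw [Finset.mem_filter] at hd
    exact Nat.mem_primeFactors.2 ⟨(hS d hd.1).1, hd.2, hn⟩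
  have h3 := Nat.le_of_dvd (Nat.pos_of_ne_zero hn) h2
  have h4 : L ^ 3 ≤ L ^ (S.filter (fun (d : ℕ) => d ∣ n)).card := Nat.pow_le_pow_right hL hc
  omega

lemma inv_sq_sum (n : ℕ) (T : Finset ℕ) (hT : T ⊆ Finset.Ioc 72 n) :
    ∑ d ∈ T, (1 : ℝ) / (d : ℝ) ^ 2 ≤ 1 / 72 := by
  calc _ ≤ ∑ d ∈ Finset.Ioc 72 (max 72 n), (1 : ℝ) / (d : ℝ) ^ 2 := by
        apply Finset.sum_le_sum_of_subset_of_nonneg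
        · exact hT.trans (Finset.Ioc_subset_Ioc_right (le_max_right _ _))
        · intros; positivity
    _ = ∑ d ∈ Finset.Ioc 72 (max 72 n), ((d : ℝ) ^ 2)⁻¹ := by simp
    _ ≤ ((72 : ℕ) : ℝ)⁻¹ - ((max 72 n : ℕ) : ℝ)⁻¹ :=
        sum_Ioc_inv_sq_le_sub (by norm_num) (le_max_left _ _)
    _ ≤ 1 / 72 := by
        have : (0 : ℝ) ≤ ((max 72 n : ℕ) : ℝ)⁻¹ := by positivity
        norm_num at this ⊢

open Classical in
/-- The good pairs. -/
noncomputable def good (k P : ℕ) (A : ℤ) (L : ℕ) : Finset ((ℤ × ℤ) × (ℤ × ℤ)) :=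
  (bx A L ×ˢ bx A L).filter (fun w =>
    (¬ ∃ d : ℕ, d.Prime ∧ (d : ℤ) ∣ nrm k P w.1 ∧ (d : ℤ) ∣ nrm k P w.2) ∧
    (¬ ∃ d : ℕ, d.Prime ∧ (d : ℤ) ∣ 1 + P * w.1.1 ∧ (d : ℤ) ∣ P * w.1.2))

lemma sieve (k P : ℕ) (hP : ∀ d : ℕ, d.Prime → d ≤ 72 → d ∣ P) (A : ℤ) (L K R : ℕ)
    (hN : ∀ u ∈ bx A L, |nrm k P u| ≤ K)
    (hR : ∀ u ∈ bx A L, 0 < (P : ℤ) * u.2 ∧ (P : ℤ) * u.2 ≤ R)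
    (hKL : K < L ^ 3) (hL : 128 ≤ L) (hRL : 32 * R ≤ L ^ 2) :
    (L : ℝ) ^ 4 / 2 ≤ (good k P A L).card := by
  classical
  set S1 := (Finset.Ioc 72 K).filter (fun (d : ℕ) => d.Prime ∧ ¬ (d : ℤ) ∣ (P : ℤ)) with hS1
  set S2 := (Finset.Ioc 72 R).filter (fun (d : ℕ) => d.Prime ∧ ¬ (d : ℤ) ∣ (P : ℤ)) with hS2
  set F : ℕ → Finset (ℤ × ℤ) := fun (d : ℕ) => (bx A L).filter (fun u => (d : ℤ) ∣ nrm k P u) with hF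
  set G : ℕ → Finset (ℤ × ℤ) := fun (d : ℕ) =>
    (bx A L).filter (fun u => (d : ℤ) ∣ 1 + P * u.1 ∧ (d : ℤ) ∣ P * u.2) with hG
  have h2P : 2 ∣ P := hP 2 Nat.prime_two (by norm_num)
  have big : ∀ d : ℕ, d.Prime → ¬ (d : ℤ) ∣ (P : ℤ) → 72 < d := by
    intro d hd h
    by_contra hc
    exact h (by exact_mod_cast hP d hd (not_lt.1 hc))
  have cover : bx A L ×ˢ bx A L ⊆ good k P A L ∪
      (S1.biUnion (fun (d : ℕ) => F d ×ˢ F d) ∪ S2.biUnion (fun (d : ℕ) => G d ×ˢ bx A L)) := by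
    intro w hw
    by_cases hg : w ∈ good k P A L
    · exact Finset.mem_union_left _ hg
    refine Finset.mem_union_right _ ?_
    have hw' := Finset.mem_product.1 hw
    rw [good, Finset.mem_filter, not_and, not_and_or, not_not, not_not] at hg
    rcases hg hw with ⟨d, hd, h1, h2⟩ | ⟨d, hd, h1, h2⟩
    · refine Finset.mem_union_left _ (Finset.mem_biUnion.2 ⟨d, ?_, ?_⟩)
      · have hdP := nrm_not_dvd k P d hd _ h1
        rw [hS1, Finset.mem_filter, Finset.mem_Ioc]
        refine ⟨⟨big d hd hdP, ?_⟩, hd, hdP⟩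
        have := Int.le_of_dvd (abs_pos.2 (nrm_ne k P h2P w.1)) ((dvd_abs _ _).2 h1)
        exact_mod_cast this.trans (hN _ hw'.1)
      · simp only [hF, Finset.mem_product, Finset.mem_filter]
        exact ⟨⟨hw'.1, h1⟩, hw'.2, h2⟩
    · refine Finset.mem_union_right _ (Finset.mem_biUnion.2 ⟨d, ?_, ?_⟩)
      · have hdP : ¬ (d : ℤ) ∣ (P : ℤ) := by
          intro h
          have : (d : ℤ) ∣ 1 := by
            have := dvd_sub h1 (h.mul_right w.1.1)
            simpa using this
          exact (Nat.prime_iff_prime_int.1 hd).not_dvd_one this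
        rw [hS2, Finset.mem_filter, Finset.mem_Ioc]
        refine ⟨⟨big d hd hdP, ?_⟩, hd, hdP⟩
        have := Int.le_of_dvd (hR _ hw'.1).1 h2
        exact_mod_cast this.trans (hR _ hw'.1).2
      · simp only [hG, Finset.mem_product, Finset.mem_filter]
        exact ⟨⟨hw'.1, h1, h2⟩, hw'.2⟩
  have hcard : (L ^ 2 * L ^ 2 : ℕ) ≤ (good k P A L).card +
      (∑ d ∈ S1, (F d).card * (F d).card + ∑ d ∈ S2, (G d).card * L ^ 2) := by
    have h := Finset.card_le_card cover
    rw [Finset.card_product, bx_card] at h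
    refine h.trans ((Finset.card_union_le _ _).trans ?_)
    gcongr
    refine (Finset.card_union_le _ _).trans ?_
    gcongr
    · refine Finset.card_biUnion_le.trans (le_of_eq ?_)
      exact Finset.sum_congr rfl fun d _ => Finset.card_product _ _
    · refine Finset.card_biUnion_le.trans (le_of_eq ?_)
      exact Finset.sum_congr rfl fun d _ => by rw [Finset.card_product, bx_card]
  have hLpos : (0 : ℝ) < L := by exact_mod_cast (by omega : 0 < L)
  have hL128 : (128 : ℝ) ≤ L := by exact_mod_cast hL
  -- small primes
  have small : ∑ d ∈ S1.filter (fun (d : ℕ) => d ≤ L), ((F d).card : ℝ) * (F d).card ≤ 16 * L ^ 4 * (1 / 72) := by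
    calc _ ≤ ∑ d ∈ S1.filter (fun (d : ℕ) => d ≤ L), 16 * (L : ℝ) ^ 4 * (1 / (d : ℝ) ^ 2) := by
          apply Finset.sum_le_sum
          intro d hd
          rw [Finset.mem_filter, hS1, Finset.mem_filter] at hd
          obtain ⟨⟨_, hdp, hdP⟩, hdL⟩ := hd
          have hd0 : (0 : ℝ) < d := by exact_mod_cast hdp.pos
          have hdL' : (d : ℝ) ≤ L := by exact_mod_cast hdL
          have h := F_card k P d hdp hdP A L
          have h1 : (1 : ℝ) ≤ L / d := by rw [le_div_iff₀ hd0]; linarith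
          have h2 : ((F d).card : ℝ) ≤ 4 * L ^ 2 / d := by
            calc ((F d).card : ℝ) ≤ L * (2 * (L / d + 1)) := h
              _ ≤ L * (2 * (L / d + L / d)) := by gcongr
              _ = _ := by ring
          calc ((F d).card : ℝ) * (F d).card ≤ (4 * L ^ 2 / d) * (4 * L ^ 2 / d) := by gcongr
            _ = _ := by field_simp; norm_num
      _ = 16 * (L : ℝ) ^ 4 * ∑ d ∈ S1.filter (fun (d : ℕ) => d ≤ L), (1 / (d : ℝ) ^ 2) := by
          rw [Finset.mul_sum]
      _ ≤ _ := by
          gcongr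
          exact inv_sq_sum K _ ((Finset.filter_subset _ _).trans (Finset.filter_subset _ _))
  have large0 : ∑ d ∈ S1.filter (fun (d : ℕ) => ¬ d ≤ L), (F d).card ≤ 2 * L ^ 2 := by
    calc _ = ∑ u ∈ bx A L, ((S1.filter (fun (d : ℕ) => ¬ d ≤ L)).filter
            (fun (d : ℕ) => d ∣ (nrm k P u).natAbs)).card := by
          simp only [hF, Finset.card_filter]
          rw [Finset.sum_comm]
          simp only [← Int.natCast_dvd]
      _ ≤ ∑ u ∈ bx A L, 2 := by
          apply Finset.sum_le_sum
          intro u hu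
          refine large_primes _ L K (Int.natAbs_ne_zero.2 (nrm_ne k P h2P u)) ?_ hKL (by omega) _ ?_
          · exact_mod_cast (Int.abs_eq_natAbs _ ▸ hN u hu : ((nrm k P u).natAbs : ℤ) ≤ K)
          · intro d hd
            rw [Finset.mem_filter, hS1, Finset.mem_filter] at hd
            exact ⟨hd.1.2.1, not_le.1 hd.2⟩
      _ = _ := by rw [Finset.sum_const, bx_card]; simp [mul_comm]
  have large : ∑ d ∈ S1.filter (fun (d : ℕ) => ¬ d ≤ L), ((F d).card : ℝ) * (F d).card ≤ 8 * L ^ 3 := by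
    calc _ ≤ ∑ d ∈ S1.filter (fun (d : ℕ) => ¬ d ≤ L), (4 * (L : ℝ)) * (F d).card := by
          apply Finset.sum_le_sum
          intro d hd
          rw [Finset.mem_filter, hS1, Finset.mem_filter] at hd
          obtain ⟨⟨_, hdp, hdP⟩, hdL⟩ := hd
          have hd0 : (0 : ℝ) < d := by exact_mod_cast hdp.pos
          have hdL' : (L : ℝ) ≤ d := by exact_mod_cast (not_le.1 hdL).le
          have h := F_card k P d hdp hdP A L
          have h1 : (L : ℝ) / d ≤ 1 := by rw [div_le_iff₀ hd0]; linarith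
          have h2 : ((F d).card : ℝ) ≤ 4 * L := by
            calc ((F d).card : ℝ) ≤ L * (2 * (L / d + 1)) := h
              _ ≤ L * (2 * (1 + 1)) := by gcongr
              _ = _ := by ring
          gcongr
      _ = (4 * (L : ℝ)) * ((∑ d ∈ S1.filter (fun (d : ℕ) => ¬ d ≤ L), (F d).card : ℕ) : ℝ) := by
          rw [← Finset.mul_sum]; push_cast; rfl
      _ ≤ (4 * (L : ℝ)) * ((2 * L ^ 2 : ℕ) : ℝ) := by gcongr
      _ = _ := by push_cast; ring
  have second : ∑ d ∈ S2, ((G d).card : ℝ) ≤ 2 * L ^ 2 * (1 / 72) + 2 * R := by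
    calc _ ≤ ∑ d ∈ S2, (2 * (L : ℝ) ^ 2 * (1 / (d : ℝ) ^ 2) + 2) := by
          apply Finset.sum_le_sum
          intro d hd
          rw [hS2, Finset.mem_filter] at hd
          have h := G_card P d hd.2.1 hd.2.2 A L
          have h1 : 2 * (L : ℝ) ^ 2 * (1 / (d : ℝ) ^ 2) = 2 * ((L : ℝ) / d) ^ 2 := by
            rw [div_pow]; ring
          rw [h1]
          refine h.trans ?_
          nlinarith [sq_nonneg ((L : ℝ) / d - 1)]
      _ = 2 * (L : ℝ) ^ 2 * ∑ d ∈ S2, (1 / (d : ℝ) ^ 2) + 2 * S2.card := by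
          rw [Finset.sum_add_distrib, Finset.mul_sum, Finset.sum_const, nsmul_eq_mul]; ring
      _ ≤ _ := by
          gcongr
          · exact inv_sq_sum R _ (Finset.filter_subset _ _)
          · refine (Finset.card_le_card (Finset.filter_subset _ _)).trans ?_
            simp
  have hR' : 32 * (R : ℝ) ≤ L ^ 2 := by exact_mod_cast hRL
  have hcard' : (L : ℝ) ^ 2 * L ^ 2 ≤ (good k P A L).card +
      (∑ d ∈ S1, ((F d).card : ℝ) * (F d).card + (∑ d ∈ S2, ((G d).card : ℝ)) * L ^ 2) := by
    rw [Finset.sum_mul]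
    exact_mod_cast hcard
  rw [← Finset.sum_filter_add_sum_filter_not S1 (fun (d : ℕ) => d ≤ L)] at hcard'
  have e1 : (∑ d ∈ S2, ((G d).card : ℝ)) * L ^ 2 ≤ (2 * L ^ 2 * (1 / 72) + 2 * R) * L ^ 2 := by gcongr
  have e2 : 2 * (R : ℝ) * L ^ 2 ≤ L ^ 4 / 16 := by nlinarith [sq_nonneg (L : ℝ)]
  have e3 : 8 * (L : ℝ) ^ 3 ≤ L ^ 4 / 16 := by
    have : (0 : ℝ) ≤ L ^ 3 := by positivity
    nlinarith
  nlinarith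

/-- Embedding of `ℤ[√k]` into the reals. -/
noncomputable def emb (k : ℕ) : ℤ√(k : ℤ) →+* ℝ := Zsqrtd.toReal (Int.natCast_nonneg k)

lemma emb_mk (k : ℕ) (a b : ℤ) : emb k ⟨a, b⟩ = (a : ℝ) + (b : ℝ) * Real.sqrt k := by
  simp [emb, Zsqrtd.toReal]

lemma emb_inj (k : ℕ) (hks : ¬ IsSquare k) : Function.Injective (emb k) := by
  apply Zsqrtd.toReal_injective
  intro n hn
  apply hks
  refine ⟨n.natAbs, ?_⟩
  have := congrArg Int.natAbs hn
  rwa [Int.natAbs_natCast, Int.natAbs_mul] at this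

lemma unit_eq_one (k : ℕ) (hk : 0 < k) (hks : ¬ IsSquare k) (e : ℤ√(k : ℤ)) (he : IsUnit e)
    (h1 : 1 / 2 ≤ emb k e) (h2 : emb k e ≤ 2) : e = 1 := by
  obtain ⟨a, b⟩ := e
  rw [emb_mk] at h1 h2
  have hk2 : 2 ≤ k := by
    by_contra hc
    have : k = 1 := by omega
    exact hks (this ▸ ⟨1, rfl⟩)
  have hs : Real.sqrt k * Real.sqrt k = k := Real.mul_self_sqrt (by positivity)
  have hs1 : 1 ≤ Real.sqrt k := by
    rw [Real.one_le_sqrt]; exact_mod_cast hk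
  set r := Real.sqrt k with hr
  have hn := Zsqrtd.norm_eq_one_iff.2 he
  rw [Zsqrtd.norm_def] at hn
  dsimp only at hn
  rcases Int.natAbs_eq_iff.1 hn with hn | hn
  · have hn' : ((a : ℝ) + b * r) * (a - b * r) = 1 := by
      have : (a : ℝ) * a - k * b * b = 1 := by exact_mod_cast hn
      linear_combination this - (b : ℝ) ^ 2 * hs
    have hy1 : 1 / 2 ≤ (a : ℝ) - b * r := by nlinarith
    have hy2 : (a : ℝ) - b * r ≤ 2 := by nlinarith
    have hb : |(b : ℝ)| < 1 := by
      have : |(b : ℝ)| * r < 1 := by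
        have hrr : |(b : ℝ)| * r = |b * r| := by
          rw [abs_mul, abs_of_pos (by linarith : 0 < r)]
        rw [hrr, abs_lt]
        constructor <;> linarith
      nlinarith [abs_nonneg (b : ℝ)]
    have hb0 : b = 0 := by
      have : |b| < 1 := by exact_mod_cast hb
      exact Int.abs_lt_one_iff.1 this
    subst hb0
    have ha : a = 1 := by
      simp only [Int.cast_zero, zero_mul, add_zero] at h1 h2
      have h3 : 0 < a := by
        have : (0 : ℝ) < a := by linarith
        exact_mod_cast this
      have h4 : a * a = 1 := by simpa using hn
      nlinarith
    subst ha
    rfl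
  · exfalso
    have hn' : ((a : ℝ) + b * r) * (a - b * r) = -1 := by
      have : (a : ℝ) * a - k * b * b = -1 := by exact_mod_cast hn
      linear_combination this - (b : ℝ) ^ 2 * hs
    have hy1 : (a : ℝ) - b * r ≤ - (1 / 2) := by nlinarith
    have hy2 : -2 ≤ (a : ℝ) - b * r := by nlinarith
    have hb : |(a : ℝ)| < 1 := by
      rw [abs_lt]; constructor <;> linarith
    have ha0 : a = 0 := by
      have : |a| < 1 := by exact_mod_cast hb
      exact Int.abs_lt_one_iff.1 this
    subst ha0
    have h5 : (k : ℤ) ∣ 1 := ⟨b * b, by push_cast at hn; linarith⟩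
    have := Int.le_of_dvd (by norm_num) h5
    omega

lemma slope_unique (k : ℕ) (hk : 0 < k) (hks : ¬ IsSquare k) (p q p' q' : ℤ√(k : ℤ))
    (h : IsCoprime p.norm q.norm) (h' : IsCoprime p'.norm q'.norm)
    (he : p * q' = p' * q) (hp : 0 < emb k p) (h1 : emb k p ≤ 2 * emb k p')
    (h2 : emb k p' ≤ 2 * emb k p) : p = p' ∧ q = q' := by
  have cop : ∀ p q : ℤ√(k : ℤ), IsCoprime p.norm q.norm → IsCoprime p q := by
    intro p q h
    have h3 := h.map (Int.castRingHom (ℤ√(k : ℤ)))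
    simp only [eq_intCast, Zsqrtd.norm_eq_mul_conj] at h3
    exact h3.of_mul_left_left.of_mul_right_left
  have d1 : p ∣ p' := (cop p q h).dvd_of_dvd_mul_right (he ▸ dvd_mul_right p q')
  have d2 : p' ∣ p := (cop p' q' h').dvd_of_dvd_mul_right (he ▸ dvd_mul_right p' q)
  obtain ⟨e, rfl⟩ := d1
  obtain ⟨f, hf⟩ := d2
  have hef : e * f = 1 := by
    apply emb_inj k hks
    have := congrArg (emb k) hf
    simp only [map_mul, map_one] at this ⊢
    have h3 : emb k p * (emb k e * emb k f) = emb k p * 1 := by linarith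
    exact mul_left_cancel₀ hp.ne' h3
  rw [map_mul] at h1 h2
  have e1 : e = 1 := by
    apply unit_eq_one k hk hks e (IsUnit.of_mul_eq_one f hef)
    · nlinarith
    · nlinarith
  subst e1
  refine ⟨by simp, ?_⟩
  apply emb_inj k hks
  have := congrArg (emb k) he
  simp only [map_mul, map_one, mul_one] at this
  exact (mul_left_cancel₀ hp.ne' this).symm

/-- Integers of absolute value at most `r`. -/
noncomputable def iv (r : ℝ) : Finset ℤ := Finset.Icc (-(⌊r⌋₊ : ℤ)) ⌊r⌋₊

lemma mem_iv {r : ℝ} (hr : 0 ≤ r) (x : ℤ) : x ∈ iv r ↔ |(x : ℝ)| ≤ r := by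
  rw [iv, Finset.mem_Icc, ← abs_le, ← Int.cast_abs, Int.abs_eq_natAbs, Int.cast_natCast,
    ← Nat.le_floor_iff hr]
  norm_cast

lemma card_iv (r : ℝ) : (iv r).card = 2 * ⌊r⌋₊ + 1 := by
  rw [iv, Int.card_Icc]; omega

lemma le_card_iv (r : ℝ) : r ≤ (iv r).card := by
  rw [card_iv]; push_cast
  have := Nat.lt_floor_add_one r
  have h : (0 : ℝ) ≤ (⌊r⌋₊ : ℝ) := by positivity
  linarith

lemma card_iv_le {r : ℝ} (hr : 1 ≤ r) : ((iv r).card : ℝ) ≤ 3 * r := by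
  rw [card_iv]; push_cast
  have := Nat.floor_le (by linarith : 0 ≤ r)
  linarith

lemma aSet_eq (k N : ℕ) : aSet k N =
    (fun z : ℤ × ℤ => emb k ⟨z.1, z.2⟩) '' ((iv (Real.sqrt N) ×ˢ iv (Real.sqrt N) : Finset (ℤ × ℤ)) : Set (ℤ × ℤ)) := by
  ext x
  simp only [aSet, Set.mem_setOf_eq, Set.mem_image, Finset.mem_coe, Finset.mem_product,
    mem_iv (Real.sqrt_nonneg _), emb_mk, Prod.exists]
  constructor
  · rintro ⟨a, b, h1, h2, rfl⟩; exact ⟨a, b, ⟨h1, h2⟩, rfl⟩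
  · rintro ⟨a, b, ⟨h1, h2⟩, rfl⟩; exact ⟨a, b, h1, h2, rfl⟩

lemma aSet_finite (k N : ℕ) : (aSet k N).Finite := by
  rw [aSet_eq]; exact (Finset.finite_toSet _).image _

lemma aSet_ncard (k N : ℕ) (hks : ¬ IsSquare k) :
    (aSet k N).ncard = (iv (Real.sqrt N)).card ^ 2 := by
  rw [aSet_eq, Set.ncard_image_of_injective, Set.ncard_coe_finset, Finset.card_product, sq]
  intro x y h
  have := emb_inj k hks h
  rw [Zsqrtd.ext_iff] at this
  exact Prod.ext this.1 this.2

lemma slope_sub (k : ℕ) (M c : ℝ) : slopeSet k M c ⊆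
    (fun w : (ℤ × ℤ) × (ℤ × ℤ) => emb k ⟨w.1.1, w.1.2⟩ / emb k ⟨w.2.1, w.2.2⟩) ''
    (((iv (Real.sqrt M) ×ˢ iv (Real.sqrt M)) ×ˢ (iv (Real.sqrt M) ×ˢ iv (Real.sqrt M)) :
      Finset ((ℤ × ℤ) × (ℤ × ℤ))) : Set ((ℤ × ℤ) × (ℤ × ℤ))) := by
  rintro s ⟨p₁, p₂, q₁, q₂, h1, h2, h3, h4, -, -, rfl⟩
  refine ⟨((p₁, p₂), (q₁, q₂)), ?_, ?_⟩
  · simp only [Finset.mem_coe, Finset.mem_product, mem_iv (Real.sqrt_nonneg _)]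
    exact ⟨⟨h1.2, h2.2⟩, h3.2, h4.2⟩
  · simp only [emb_mk]

lemma slope_finite (k : ℕ) (M c : ℝ) : (slopeSet k M c).Finite :=
  ((Finset.finite_toSet _).image _).subset (slope_sub k M c)

lemma slope_le (k N : ℕ) (hks : ¬ IsSquare k) (M c : ℝ) (hM : M ≤ N) :
    (slopeSet k M c).ncard ≤ (aSet k N).ncard ^ 2 := by
  rw [aSet_ncard k N hks]
  refine (Set.ncard_le_ncard (slope_sub k M c) ((Finset.finite_toSet _).image _)).trans ?_
  refine (Set.ncard_image_le (Finset.finite_toSet _)).trans ?_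
  rw [Set.ncard_coe_finset]
  simp only [Finset.card_product]
  have : (iv (Real.sqrt M)).card ≤ (iv (Real.sqrt N)).card := by
    rw [card_iv, card_iv]
    gcongr
  calc _ ≤ (iv (Real.sqrt N)).card * (iv (Real.sqrt N)).card *
        ((iv (Real.sqrt N)).card * (iv (Real.sqrt N)).card) := by gcongr
    _ = _ := by ring

lemma energy_lower (k N : ℕ) (hk : 0 < k) (hks : ¬ IsSquare k) (M : ℝ) (hM : 1 ≤ M)
    (p₁ p₂ q₁ q₂ : ℤ)
    (hp1 : |(p₁ : ℝ)| ≤ Real.sqrt M) (hp2 : |(p₂ : ℝ)| ≤ Real.sqrt M)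
    (hq1 : |(q₁ : ℝ)| ≤ Real.sqrt M) (hq2 : |(q₂ : ℝ)| ≤ Real.sqrt M)
    (hp0 : p₁ ≠ 0) (hq0 : q₁ ≠ 0) :
    (N : ℝ) ^ 3 / (64 * (1 + k) ^ 2 * M) ≤
      addEnergy (aSet k N) ((fun b => (emb k ⟨p₁, p₂⟩ / emb k ⟨q₁, q₂⟩) * b) '' aSet k N) := by
  set p : ℤ√(k : ℤ) := ⟨p₁, p₂⟩ with hp
  set q : ℤ√(k : ℤ) := ⟨q₁, q₂⟩ with hq
  have hpe : emb k p ≠ 0 := by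
    rw [Ne, map_eq_zero_iff _ (emb_inj k hks), hp, Zsqrtd.ext_iff]; exact fun h => hp0 h.1
  have hqe : emb k q ≠ 0 := by
    rw [Ne, map_eq_zero_iff _ (emb_inj k hks), hq, Zsqrtd.ext_iff]; exact fun h => hq0 h.1
  set x := emb k p / emb k q with hx
  have hx0 : x ≠ 0 := div_ne_zero hpe hqe
  have hsM : 1 ≤ Real.sqrt M := Real.one_le_sqrt.2 hM
  have hk0 : (1 : ℝ) ≤ k := by exact_mod_cast hk
  set sN := Real.sqrt N with hsN
  have hsN0 : 0 ≤ sN := Real.sqrt_nonneg _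
  set τ : ℝ := sN / (2 * (1 + k) * Real.sqrt M) with hτ
  have hτ0 : 0 ≤ τ := by positivity
  have hτe : (1 + k) * Real.sqrt M * τ = sN / 2 := by
    rw [hτ]; field_simp
  -- membership
  have memA : ∀ z : ℤ√(k : ℤ), |(z.re : ℝ)| ≤ sN → |(z.im : ℝ)| ≤ sN → emb k z ∈ aSet k N := by
    rintro ⟨a, b⟩ h1 h2
    exact ⟨a, b, h1, h2, emb_mk k a b⟩
  have small : ∀ (u₁ u₂ t₁ t₂ a b : ℤ), |(u₁ : ℝ)| ≤ Real.sqrt M → |(u₂ : ℝ)| ≤ Real.sqrt M →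
      |(t₁ : ℝ)| ≤ τ → |(t₂ : ℝ)| ≤ τ → |(a : ℝ)| ≤ sN / 2 → |(b : ℝ)| ≤ sN / 2 →
      emb k ((⟨a, b⟩ : ℤ√(k : ℤ)) + ⟨u₁, u₂⟩ * ⟨t₁, t₂⟩) ∈ aSet k N := by
    intro u₁ u₂ t₁ t₂ a b hu1 hu2 ht1 ht2 ha hb
    have m : ∀ u t : ℝ, |u| ≤ Real.sqrt M → |t| ≤ τ → |u * t| ≤ Real.sqrt M * τ := by
      intro u t h1 h2
      rw [abs_mul]; gcongr
    have m11 := m _ _ hu1 ht1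
    have m12 := m _ _ hu1 ht2
    have m21 := m _ _ hu2 ht1
    have m22 := m _ _ hu2 ht2
    have hst : 0 ≤ Real.sqrt M * τ := by positivity
    apply memA
    · simp only [Zsqrtd.re_add, Zsqrtd.re_mul]
      push_cast
      have e : (k : ℝ) * u₂ * t₂ = k * (u₂ * t₂) := by ring
      have : |(k : ℝ) * (u₂ * t₂)| ≤ k * (Real.sqrt M * τ) := by
        rw [abs_mul, abs_of_nonneg (by linarith : (0 : ℝ) ≤ k)]; gcongr
      rw [e]
      refine (abs_add_le _ _).trans ?_
      have := abs_add_le ((u₁ : ℝ) * t₁) (k * (u₂ * t₂))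
      nlinarith
    · simp only [Zsqrtd.im_add, Zsqrtd.im_mul]
      push_cast
      refine (abs_add_le _ _).trans ?_
      have := abs_add_le ((u₁ : ℝ) * t₂) (u₂ * t₁)
      nlinarith
  set J := iv (sN / 2) with hJ
  set I := iv τ with hI
  set dom : Finset (((ℤ × ℤ) × (ℤ × ℤ)) × (ℤ × ℤ)) := ((J ×ˢ J) ×ˢ (J ×ˢ J)) ×ˢ (I ×ˢ I) with hdom
  set f : ((ℤ × ℤ) × (ℤ × ℤ)) × (ℤ × ℤ) → ℝ × ℝ × ℝ × ℝ := fun w =>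
    (emb k (⟨w.1.1.1, w.1.1.2⟩ + p * ⟨w.2.1, w.2.2⟩), emb k ⟨w.1.1.1, w.1.1.2⟩,
      x * emb k ⟨w.1.2.1, w.1.2.2⟩, x * emb k (⟨w.1.2.1, w.1.2.2⟩ + q * ⟨w.2.1, w.2.2⟩)) with hf
  have hfinj : Function.Injective f := by
    rintro ⟨⟨⟨a, a'⟩, ⟨b, b'⟩⟩, ⟨t, t'⟩⟩ ⟨⟨⟨c, c'⟩, ⟨d, d'⟩⟩, ⟨s, s'⟩⟩ h
    simp only [hf, Prod.mk.injEq, map_add, map_mul] at h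
    obtain ⟨h1, h2, h3, -⟩ := h
    rw [h2] at h1
    have h1' := emb_inj k hks (mul_left_cancel₀ hpe (add_left_cancel h1))
    have h2' := emb_inj k hks h2
    have h3' := emb_inj k hks (mul_left_cancel₀ hx0 h3)
    rw [Zsqrtd.ext_iff] at h1' h2' h3'
    simp only at h1' h2' h3'
    simp [h1', h2', h3']
  set E := {y : ℝ × ℝ × ℝ × ℝ | y.1 ∈ aSet k N ∧ y.2.1 ∈ aSet k N ∧
    y.2.2.1 ∈ ((fun b => x * b) '' aSet k N) ∧ y.2.2.2 ∈ ((fun b => x * b) '' aSet k N) ∧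
    y.1 + y.2.2.1 = y.2.1 + y.2.2.2} with hE
  have hfin : E.Finite := by
    have hB := (aSet_finite k N).image (fun b => x * b)
    refine ((aSet_finite k N).prod ((aSet_finite k N).prod (hB.prod hB))).subset ?_
    rintro y ⟨h1, h2, h3, h4, -⟩
    exact ⟨h1, h2, h3, h4⟩
  have hsub : f '' (dom : Set _) ⊆ E := by
    rintro _ ⟨⟨⟨⟨a, a'⟩, ⟨b, b'⟩⟩, ⟨t, t'⟩⟩, hw, rfl⟩
    simp only [hdom, Finset.mem_coe, Finset.mem_product, hJ, hI, mem_iv hτ0,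
      mem_iv (by linarith : 0 ≤ sN / 2)] at hw
    obtain ⟨⟨⟨ha, ha'⟩, hb, hb'⟩, ht, ht'⟩ := hw
    simp only [hE, hf, Set.mem_setOf_eq]
    refine ⟨small _ _ _ _ _ _ hp1 hp2 ht ht' ha ha', memA _ (by dsimp only; linarith) (by dsimp only; linarith),
      ⟨_, memA ⟨b, b'⟩ (by dsimp only; linarith) (by dsimp only; linarith), rfl⟩,
      ⟨_, small _ _ _ _ _ _ hq1 hq2 ht ht' hb hb', rfl⟩, ?_⟩
    simp only [map_add, map_mul, hx]
    field_simp
    ring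
  have hcard : (dom.card : ℝ) ≤ E.ncard := by
    rw [← Set.ncard_coe_finset, ← Set.ncard_image_of_injective _ hfinj]
    exact_mod_cast Set.ncard_le_ncard hsub hfin
  refine le_trans ?_ hcard
  simp only [hdom, Finset.card_product]
  push_cast
  have hJc : sN / 2 ≤ J.card := le_card_iv _
  have hIc : τ ≤ I.card := le_card_iv _
  have hN2 : sN ^ 2 = N := Real.sq_sqrt (by positivity)
  have hM2 : Real.sqrt M ^ 2 = M := Real.sq_sqrt (by linarith)
  calc (N : ℝ) ^ 3 / (64 * (1 + k) ^ 2 * M) =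
      ((sN / 2) * (sN / 2)) * ((sN / 2) * (sN / 2)) * (τ * τ) := by
        rw [hτ]
        conv_lhs => rw [← hN2, ← hM2]
        field_simp
        norm_num
    _ ≤ _ := by gcongr

lemma mem_good (k P : ℕ) (A : ℤ) (L : ℕ) (w : (ℤ × ℤ) × (ℤ × ℤ)) : w ∈ good k P A L ↔
    w ∈ bx A L ×ˢ bx A L ∧
    (¬ ∃ d : ℕ, d.Prime ∧ (d : ℤ) ∣ nrm k P w.1 ∧ (d : ℤ) ∣ nrm k P w.2) ∧
    (¬ ∃ d : ℕ, d.Prime ∧ (d : ℤ) ∣ 1 + P * w.1.1 ∧ (d : ℤ) ∣ P * w.1.2) := by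
  classical
  rw [good, Finset.mem_filter]

set_option maxHeartbeats 4000000 in
lemma slope_lower (k : ℕ) (hk : 0 < k) (hks : ¬ IsSquare k) (c : ℝ) (hc : 1 / 2 < c) (hc1 : c < 1) :
    ∃ δ : ℝ, 0 < δ ∧ ∀ M : ℝ, 1 ≤ M → (slopeSet k M c).Nonempty →
      δ * M ^ 2 ≤ (slopeSet k M c).ncard := by
  obtain ⟨P, hP, hPpos⟩ : ∃ P : ℕ, (∀ d : ℕ, d.Prime → d ≤ 72 → d ∣ P) ∧ 0 < P :=
    ⟨Nat.factorial 72, fun d hd h => Nat.dvd_factorial hd.pos h, Nat.factorial_pos _⟩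
  have hP1 : (1 : ℝ) ≤ P := by exact_mod_cast hPpos
  have hP0 : (0 : ℝ) < P := by linarith
  have hk1 : (1 : ℝ) ≤ k := by exact_mod_cast hk
  set η : ℝ := (1 - c) / (2 * P) with hη
  have hη0 : 0 < η := div_pos (by linarith) (by positivity)
  set s0 : ℝ := 1 + 128 / η + k / η ^ 3 + 32 / η ^ 2 with hs0
  have hs01 : 0 < s0 := by positivity
  refine ⟨min (η ^ 4 / 2) (1 / s0 ^ 4), lt_min (by positivity) (by positivity), ?_⟩
  intro M hM hne
  set s := Real.sqrt M with hs
  have hs1 : 1 ≤ s := Real.one_le_sqrt.2 hM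
  have hsM : s ^ 2 = M := Real.sq_sqrt (by linarith)
  have hM2 : M ^ 2 = s ^ 4 := by rw [← hsM]; ring
  rw [hM2]
  rcases lt_or_ge s s0 with hlt | hge
  · have h1 : (1 : ℝ) ≤ (slopeSet k M c).ncard := by
      have := (Set.ncard_pos (slope_finite k M c)).2 hne
      exact_mod_cast this
    refine le_trans ?_ h1
    calc _ ≤ 1 / s0 ^ 4 * s0 ^ 4 := by
          gcongr
          exact min_le_right _ _
      _ = 1 := by field_simp
  have hpos1 : 0 < 128 / η := by positivity
  have hpos2 : 0 < k / η ^ 3 := by positivity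
  have hpos3 : 0 < 32 / η ^ 2 := by positivity
  have g1 : 128 ≤ η * s := by
    have : 128 / η ≤ s := by linarith
    rw [div_le_iff₀ hη0] at this; linarith
  have g2 : (k : ℝ) < η ^ 3 * s := by
    have : k / η ^ 3 < s := by linarith
    rw [div_lt_iff₀ (by positivity)] at this; linarith
  have g3 : 32 ≤ η ^ 2 * s := by
    have : 32 / η ^ 2 ≤ s := by linarith
    rw [div_le_iff₀ (by positivity)] at this; linarith
  set y : ℝ := 2 * (η * s) with hy
  have hPy : P * y = (1 - c) * s := by rw [hy, hη]; field_simp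
  set L : ℕ := ⌊y⌋₊ - 3 with hL
  have hfl : 3 ≤ ⌊y⌋₊ := Nat.le_floor (by push_cast; linarith)
  have hLr : (L : ℝ) = (⌊y⌋₊ : ℝ) - 3 := by rw [hL]; push_cast [Nat.cast_sub hfl]; ring
  have hLy : (L : ℝ) ≤ y - 3 := by
    have := Nat.floor_le (by linarith : 0 ≤ y)
    linarith
  have hLs : η * s ≤ L := by
    have := Nat.lt_floor_add_one y
    linarith
  set A : ℤ := ⌈c * s / P⌉ with hA
  have hA1 : c * s ≤ P * (A : ℝ) := by
    have := Int.le_ceil (c * s / P)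
    rw [div_le_iff₀ hP0] at this
    linarith
  have hA2 : P * (A : ℝ) < c * s + P := by
    have := Int.ceil_lt_add_one (c * s / P)
    have h2 : (P : ℝ) * A < P * (c * s / P + 1) := by gcongr
    have h3 : (P : ℝ) * (c * s / P + 1) = c * s + P := by field_simp
    linarith
  have rng : ∀ a : ℤ, a ∈ Finset.Ico A (A + L) → c * s ≤ P * (a : ℝ) ∧ 1 + P * (a : ℝ) ≤ s := by
    intro a ha
    rw [Finset.mem_Ico] at ha
    have h1 : (A : ℝ) ≤ a := by exact_mod_cast ha.1
    have h2 : (a : ℝ) + 1 ≤ A + L := by exact_mod_cast ha.2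
    constructor
    · nlinarith
    · nlinarith
  have hcs : 0 < c * s := by nlinarith
  have mb : ∀ u ∈ bx A L, (c * s ≤ P * (u.1 : ℝ) ∧ 1 + P * (u.1 : ℝ) ≤ s) ∧
      (c * s ≤ P * (u.2 : ℝ) ∧ 1 + P * (u.2 : ℝ) ≤ s) := by
    intro u hu
    rw [bx, Finset.mem_product] at hu
    exact ⟨rng _ hu.1, rng _ hu.2⟩
  have hLpos : (0 : ℝ) < L := by linarith
  have hsieve : (L : ℝ) ^ 4 / 2 ≤ (good k P A L).card := by
    apply sieve k P hP A L ⌊(k : ℝ) * s ^ 2⌋₊ ⌊s⌋₊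
    · intro u hu
      obtain ⟨⟨h1, h2⟩, h3, h4⟩ := mb u hu
      rw [Int.abs_eq_natAbs]
      have : ((nrm k P u).natAbs : ℝ) ≤ k * s ^ 2 := by
        rw [← Int.cast_natCast, ← Int.abs_eq_natAbs, Int.cast_abs, nrm]
        push_cast
        have e1 : (1 + (P : ℝ) * u.1) ^ 2 ≤ s ^ 2 := by
          apply pow_le_pow_left₀ _ h2; linarith
        have e2 : ((P : ℝ) * u.2) ^ 2 ≤ s ^ 2 := by
          apply pow_le_pow_left₀ <;> linarith
        have e3 : (k : ℝ) * ((P : ℝ) * u.2) ^ 2 ≤ k * s ^ 2 := by gcongr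
        have e4 : 0 ≤ (k : ℝ) * ((P : ℝ) * u.2) ^ 2 := by positivity
        have e5 : 0 ≤ (1 + (P : ℝ) * u.1) ^ 2 := by positivity
        have e6 : s ^ 2 ≤ k * s ^ 2 := by nlinarith [sq_nonneg s]
        rw [abs_le]; constructor <;> linarith
      exact_mod_cast Nat.le_floor this
    · intro u hu
      obtain ⟨⟨h1, h2⟩, h3, h4⟩ := mb u hu
      constructor
      · have : (0 : ℝ) < P * (u.2 : ℝ) := by linarith
        exact_mod_cast this
      · have h5 : (0 : ℝ) < P * (u.2 : ℝ) := by linarith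
        have h6 : 0 ≤ (P : ℤ) * u.2 := by exact_mod_cast h5.le
        obtain ⟨n, hn⟩ := Int.eq_ofNat_of_zero_le h6
        rw [hn]
        have h7 : (P : ℝ) * u.2 = n := by exact_mod_cast hn
        exact_mod_cast Nat.le_floor (by linarith : (n : ℝ) ≤ s)
    · rw [Nat.floor_lt (by positivity)]
      push_cast
      calc (k : ℝ) * s ^ 2 < η ^ 3 * s * s ^ 2 := by gcongr
        _ = (η * s) ^ 3 := by ring
        _ ≤ L ^ 3 := by gcongr
    · exact_mod_cast g1.trans hLs
    · have h1 : 32 * s ≤ (L : ℝ) ^ 2 := by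
        calc 32 * s ≤ η ^ 2 * s * s := by gcongr
          _ = (η * s) ^ 2 := by ring
          _ ≤ L ^ 2 := by gcongr
      have h2 := Nat.floor_le (by linarith : 0 ≤ s)
      have h3 : 32 * (⌊s⌋₊ : ℝ) ≤ (L : ℝ) ^ 2 := by linarith
      exact_mod_cast h3
  set Z : ℤ × ℤ → ℤ√(k : ℤ) := fun u => ⟨1 + P * u.1, P * u.2⟩ with hZ
  have hZn : ∀ u, (Z u).norm = nrm k P u := by
    intro u
    rw [hZ, Zsqrtd.norm_def, nrm]; ring
  have hZe : ∀ u, emb k (Z u) = (1 + P * (u.1 : ℝ)) + P * (u.2 : ℝ) * Real.sqrt k := by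
    intro u
    rw [hZ, emb_mk]; push_cast; ring
  have hrk : 0 ≤ Real.sqrt k := Real.sqrt_nonneg _
  have hZpos : ∀ u ∈ bx A L, 0 < emb k (Z u) ∧ c * (s * (1 + Real.sqrt k)) ≤ emb k (Z u) ∧
      emb k (Z u) ≤ s * (1 + Real.sqrt k) := by
    intro u hu
    obtain ⟨⟨h1, h2⟩, h3, h4⟩ := mb u hu
    rw [hZe]
    have e1 : c * s * Real.sqrt k ≤ P * (u.2 : ℝ) * Real.sqrt k := by gcongr
    have e2 : P * (u.2 : ℝ) * Real.sqrt k ≤ s * Real.sqrt k := by gcongr; linarith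
    have e3 : 0 ≤ c * s * Real.sqrt k := by positivity
    refine ⟨by linarith, by linarith, by linarith⟩
  have copr : ∀ w ∈ good k P A L, IsCoprime (Z w.1).norm (Z w.2).norm := by
    intro w hw
    rw [mem_good] at hw
    rw [hZn, hZn, Int.isCoprime_iff_gcd_eq_one]
    by_contra hg
    obtain ⟨d, hd, hdg⟩ := Nat.exists_prime_and_dvd hg
    have hdz : (d : ℤ) ∣ ((Int.gcd (nrm k P w.1) (nrm k P w.2) : ℕ) : ℤ) := by exact_mod_cast hdg
    exact hw.2.1 ⟨d, hd, hdz.trans (Int.gcd_dvd_left ..), hdz.trans (Int.gcd_dvd_right ..)⟩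
  have memb : ∀ w ∈ good k P A L, w.1 ∈ bx A L ∧ w.2 ∈ bx A L := by
    intro w hw
    rw [mem_good, Finset.mem_product] at hw
    exact hw.1
  set g : (ℤ × ℤ) × (ℤ × ℤ) → ℝ := fun w => emb k (Z w.1) / emb k (Z w.2) with hg
  have ginj : Set.InjOn g (good k P A L : Set _) := by
    intro w hw w' hw' h
    have hw := Finset.mem_coe.1 hw
    have hw' := Finset.mem_coe.1 hw'
    obtain ⟨p1, p2, p3⟩ := hZpos _ (memb w hw).1
    obtain ⟨p1', p2', p3'⟩ := hZpos _ (memb w' hw').1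
    have q1 := (hZpos _ (memb w hw).2).1
    have q1' := (hZpos _ (memb w' hw').2).1
    have hmul : Z w.1 * Z w'.2 = Z w'.1 * Z w.2 := by
      apply emb_inj k hks
      rw [map_mul, map_mul]
      simp only [hg] at h
      rwa [div_eq_div_iff q1.ne' q1'.ne'] at h
    have hX : 0 < s * (1 + Real.sqrt k) := by positivity
    obtain ⟨h1, h2⟩ := slope_unique k hk hks _ _ _ _ (copr w hw) (copr w' hw') hmul p1
      (by nlinarith) (by nlinarith)
    have Zinj : ∀ u v, Z u = Z v → u = v := by
      intro u v huv
      simp only [hZ, Zsqrtd.ext_iff] at huv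
      have hPz : (P : ℤ) ≠ 0 := by exact_mod_cast hPpos.ne'
      exact Prod.ext (mul_left_cancel₀ hPz (add_left_cancel huv.1)) (mul_left_cancel₀ hPz huv.2)
    exact Prod.ext (Zinj _ _ h1) (Zinj _ _ h2)
  have gsub : g '' (good k P A L : Set _) ⊆ slopeSet k M c := by
    rintro _ ⟨w, hw, rfl⟩
    have hw := Finset.mem_coe.1 hw
    obtain ⟨⟨a1, a2⟩, a3, a4⟩ := mb _ (memb w hw).1
    obtain ⟨⟨b1, b2⟩, b3, b4⟩ := mb _ (memb w hw).2
    rw [mem_good] at hw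
    have ab : ∀ t : ℝ, c * s ≤ t → t ≤ s → c * s ≤ |t| ∧ |t| ≤ s := by
      intro t h1 h2
      rw [abs_of_pos (by linarith)]; exact ⟨h1, h2⟩
    refine ⟨1 + P * w.1.1, P * w.1.2, 1 + P * w.2.1, P * w.2.2, ?_, ?_, ?_, ?_, ?_, ?_, ?_⟩
    · push_cast; exact ab _ (by linarith) (by linarith)
    · push_cast; exact ab _ (by linarith) (by linarith)
    · push_cast; exact ab _ (by linarith) (by linarith)
    · push_cast; exact ab _ (by linarith) (by linarith)
    · rintro ⟨d, hd, -, h1, h2⟩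
      exact hw.2.1 ⟨d, hd, h1, h2⟩
    · rintro ⟨d, hd, -, h1, h2⟩
      exact hw.2.2 ⟨d, hd, h1, h2⟩
    · simp only [hg, hZe]; push_cast; rfl
  have hfinal : ((good k P A L).card : ℝ) ≤ (slopeSet k M c).ncard := by
    rw [← Set.ncard_coe_finset, ← Set.ncard_image_of_injOn ginj]
    exact_mod_cast Set.ncard_le_ncard gsub (slope_finite k M c)
  calc _ ≤ η ^ 4 / 2 * s ^ 4 := by
        gcongr
        exact min_le_left _ _
    _ = (η * s) ^ 4 / 2 := by ring
    _ ≤ (L : ℝ) ^ 4 / 2 := by gcongr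
    _ ≤ _ := hsieve.trans hfinal

/-- Sharpness of the energy bound for `A = B = A_N` and `X = S` the slope set. -/
theorem energy_bound_sharp (k : ℕ) (hk : 0 < k) (hks : ¬ IsSquare k) :
    ∃ cstar : ℝ, 0 < cstar ∧ cstar < 1 ∧
      ∀ c : ℝ, cstar < c → c < 1 →
        ∃ c₅ : ℝ, 0 < c₅ ∧ ∃ N₀ : ℕ,
          ∀ N : ℕ, N₀ ≤ N → ∀ M : ℝ, 1 ≤ M → M ≤ (N : ℝ) →
            (slopeSet k M c).ncard ≤ (aSet k N).ncard ^ 2 ∧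
            c₅ * ((aSet k N).ncard : ℝ) ^ 3 *
                ((slopeSet k M c).ncard : ℝ) ^ ((1 : ℝ) / 2) ≤
              ∑ᶠ x ∈ slopeSet k M c,
                (addEnergy (aSet k N) ((fun b => x * b) '' aSet k N) : ℝ) := by
  refine ⟨1 / 2, by norm_num, by norm_num, ?_⟩
  intro c hc hc1
  obtain ⟨δ, hδ, hlow⟩ := slope_lower k hk hks c hc hc1
  refine ⟨Real.sqrt δ / (729 * (64 * (1 + k) ^ 2)), by positivity, 0, ?_⟩
  intro N _ M hM hMN
  refine ⟨slope_le k N hks M c hMN, ?_⟩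
  have hfin := slope_finite k M c
  rcases (slopeSet k M c).eq_empty_or_nonempty with he | hne
  · rw [he]
    simp
  have hX := hlow M hM hne
  set X : ℝ := ((slopeSet k M c).ncard : ℝ) with hXdef
  have hX0 : 0 ≤ X := by positivity
  have hM0 : 0 < M := by linarith
  have hsum : X * ((N : ℝ) ^ 3 / (64 * (1 + k) ^ 2 * M)) ≤ ∑ᶠ x ∈ slopeSet k M c,
      (addEnergy (aSet k N) ((fun b => x * b) '' aSet k N) : ℝ) := by
    rw [finsum_mem_eq_finite_toFinset_sum _ hfin, hXdef, Set.ncard_eq_toFinset_card _ hfin,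
      ← nsmul_eq_mul]
    apply Finset.card_nsmul_le_sum
    intro x hx
    rw [Set.Finite.mem_toFinset] at hx
    obtain ⟨p₁, p₂, q₁, q₂, h1, h2, h3, h4, -, -, rfl⟩ := hx
    have hcs : 0 < c * Real.sqrt M := mul_pos (by linarith) (Real.sqrt_pos.2 hM0)
    have h := energy_lower k N hk hks M hM p₁ p₂ q₁ q₂ h1.2 h2.2 h3.2 h4.2
      (by rintro rfl; simp at h1; linarith) (by rintro rfl; simp at h3; linarith)
    rwa [emb_mk, emb_mk] at h
  refine le_trans ?_ hsum
  have hA : ((aSet k N).ncard : ℝ) ≤ 9 * N := by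
    rw [aSet_ncard k N hks]
    push_cast
    have h1 := card_iv_le (r := Real.sqrt N) (Real.one_le_sqrt.2 (hM.trans hMN))
    have h2 : Real.sqrt N ^ 2 = N := Real.sq_sqrt (by positivity)
    calc ((iv (Real.sqrt N)).card : ℝ) ^ 2 ≤ (3 * Real.sqrt N) ^ 2 := by gcongr
      _ = 9 * (N : ℝ) := by rw [mul_pow, h2]; norm_num
  rw [← Real.sqrt_eq_rpow]
  have hr : Real.sqrt δ * M ≤ Real.sqrt X := by
    rw [← Real.sqrt_sq hM0.le, ← Real.sqrt_mul hδ.le]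
    exact Real.sqrt_le_sqrt hX
  have hXX : Real.sqrt X * Real.sqrt X = X := Real.mul_self_sqrt hX0
  calc Real.sqrt δ / (729 * (64 * (1 + k) ^ 2)) * ((aSet k N).ncard : ℝ) ^ 3 * Real.sqrt X
      ≤ Real.sqrt δ / (729 * (64 * (1 + k) ^ 2)) * (9 * N) ^ 3 * Real.sqrt X := by gcongr
    _ = (Real.sqrt δ * M) * Real.sqrt X * ((N : ℝ) ^ 3 / (64 * (1 + k) ^ 2 * M)) := by
        field_simp
        norm_num
    _ ≤ Real.sqrt X * Real.sqrt X * ((N : ℝ) ^ 3 / (64 * (1 + k) ^ 2 * M)) := by gcongr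
    _ = _ := by rw [hXX]
end
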